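/- arXiv:2008.12167 — 3 statements merged into one kernel-verified Lean document; each statement's English description precedes it below -/
import Mathlib

section
/- Let (G(d^n),T(d^n),Γ(d^n)) be a random tree-rooted graph with degree sequence d^n, let d^n_−(i) denote the degree of vertex i in the multigraph G(d^n) − T(d^n), and for integers k,ℓ ≥ 0 let A^n(k,ℓ) be the number of non-root vertices u of T(d^n) with d^n_−(u) = k and d^n_−(parent(u)) = ℓ. Then for all k,ℓ ≥ 0, n^{−1}·A^n(k,ℓ) → α(k,ℓ) in probability as n → ∞, and moreover n^{−1}·∑_{k,ℓ≥0} kℓ·A^n(k,ℓ) → ∑_{k,ℓ≥0} kℓ·α(k,ℓ) in probability. -/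
open Classical Filter

namespace TWG

/-- Half-edges for the degree sequence `d`: vertex `i` carries `d i` half-edges,
encoded as `⟨i, j⟩` for `j : Fin (d i)`; `⟨i, d i - 1⟩` is the root half-edge of `i`. -/
abbrev HE {n : ℕ} (d : Fin n → ℕ) := (i : Fin n) × Fin (d i)

def IsRootHE {n : ℕ} (d : Fin n → ℕ) (h : HE d) : Prop := (h.2 : ℕ) = d h.1 - 1

def IsNonRootHE {n : ℕ} (d : Fin n → ℕ) (h : HE d) : Prop := (h.2 : ℕ) < d h.1 - 1

/-- A candidate execution path: at each of the `n-1` steps, a pair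
(root half-edge `r_k`, non-root half-edge `s_k`) is chosen. -/
abbrev Path {n : ℕ} (d : Fin n → ℕ) := Fin (n - 1) → HE d × HE d

/-- Vertices `a` and `b` lie in the same tree of the forest present at the start of
step `k`, i.e. they are joined by the edges created at steps `j < k`. -/
def SameTree {n : ℕ} {d : Fin n → ℕ} (E : Path d) (k : Fin (n - 1)) (a b : Fin n) : Prop :=
  Relation.ReflTransGen
    (fun x y => ∃ j, j < k ∧
      (((E j).1.1 = x ∧ (E j).2.1 = y) ∨ ((E j).1.1 = y ∧ (E j).2.1 = x))) a b

/-- `E` is a valid execution path of Pitman's additive coalescent for `d`: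
at each step, `r_k` is an as-yet-unpaired root half-edge, `s_k` is an
as-yet-unpaired non-root half-edge, and they lie in different trees of the
current forest. -/
def IsExecPath {n : ℕ} (d : Fin n → ℕ) (E : Path d) : Prop :=
  ∀ k : Fin (n - 1),
    IsRootHE d (E k).1 ∧ IsNonRootHE d (E k).2 ∧
    (∀ j, j < k → (E j).1 ≠ (E k).1) ∧
    (∀ j, j < k → (E j).2 ≠ (E k).2) ∧
    ¬ SameTree E k (E k).1.1 (E k).2.1

/-- The number of children of vertex `i` in the tree `T(d)` built by `E`. -/
noncomputable def cc {n : ℕ} {d : Fin n → ℕ} (E : Path d) (i : Fin n) : ℕ :=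
  Nat.card {k : Fin (n - 1) // (E k).2.1 = i}

/-- `v` is a non-root vertex of the tree built by `E`. -/
def IsNonRootV {n : ℕ} {d : Fin n → ℕ} (E : Path d) (v : Fin n) : Prop :=
  ∃ k, (E k).1.1 = v

/-- The parent of `v` in the tree built by `E` (equal to `v` itself for the root). -/
noncomputable def parentOf {n : ℕ} {d : Fin n → ℕ} (E : Path d) (v : Fin n) : Fin n :=
  if h : ∃ k, (E k).1.1 = v then (E h.choose).2.1 else v

/-- The tree built by `E` is the rooted tree with root `root` and parent map `par`. -/
def TreeEq {n : ℕ} {d : Fin n → ℕ} (E : Path d) (root : Fin n) (par : Fin n → Fin n) : Prop :=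
  (∀ k, par (E k).1.1 = (E k).2.1) ∧ ∀ v, v ≠ root → ∃ k, (E k).1.1 = v

/-- `(root, par)` encodes a rooted tree on `Fin n`: the root is a fixed point of the
parent map and every vertex reaches the root by iterating the parent map. -/
def IsRootedTree {n : ℕ} (root : Fin n) (par : Fin n → Fin n) : Prop :=
  par root = root ∧ ∀ v, ∃ m, par^[m] v = root

/-- The number of children of `i` in the rooted tree `(root, par)`. -/
noncomputable def childCount {n : ℕ} (root : Fin n) (par : Fin n → Fin n) (i : Fin n) : ℕ :=
  Nat.card {v : Fin n // v ≠ root ∧ par v = i}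

/-- `h` is one of the half-edges paired during the execution path `E`. -/
def UsedIn {n : ℕ} {d : Fin n → ℕ} (E : Path d) (h : HE d) : Prop :=
  (∃ k, (E k).1 = h) ∨ (∃ k, (E k).2 = h)

/-- `M` pairs up, as a fixed-point-free involution, exactly the half-edges left
unpaired by `E` (its fixed points are exactly the half-edges used by `E`). -/
def IsCompletion {n : ℕ} {d : Fin n → ℕ} (E : Path d) (M : HE d → HE d) : Prop :=
  Function.Involutive M ∧ ∀ h, (M h = h ↔ UsedIn E h)

/-- The number of half-edges at `u`, unpaired by `E`, which `M` matches to a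
half-edge at `v`.  For `u ≠ v` this is the number of `M`-edges joining `u` and `v`;
for `u = v` it is twice the number of `M`-loops at `u`. -/
noncomputable def matchCount {n : ℕ} {d : Fin n → ℕ} (E : Path d) (M : HE d → HE d)
    (u v : Fin n) : ℕ :=
  Nat.card {h : HE d // ¬ UsedIn E h ∧ h.1 = u ∧ (M h).1 = v}

/-- `P(Bin(m, ρ) = a)`. -/
noncomputable def binomP (ρ : ℝ) (m a : ℕ) : ℝ :=
  (m.choose a : ℝ) * ρ ^ a * (1 - ρ) ^ (m - a)


/-- `μ₁(p) = ∑ k, k⋅p(k)`. -/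
noncomputable def mu1 (p : ℕ → ℝ) : ℝ := ∑' k : ℕ, (k : ℝ) * p k

/-- `ρ = 1/(μ₁(p) - 1)`. -/
noncomputable def rho (p : ℕ → ℝ) : ℝ := 1 / (mu1 p - 1)

/-- `α(k,ℓ) = ∑_{a₁,a₂ ≥ 0} a₂ p(ℓ+a₂+1) P(Bin(ℓ+a₂,ρ)=a₂) ⋅ p(k+a₁+1) P(Bin(k+a₁,ρ)=a₁)`. -/
noncomputable def alphaF (p : ℕ → ℝ) (k l : ℕ) : ℝ :=
  ∑' a : ℕ × ℕ, (a.2 : ℝ) * p (l + a.2 + 1) * binomP (rho p) (l + a.2) a.2 *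
    (p (k + a.1 + 1) * binomP (rho p) (k + a.1) a.1)

/-- The degree of `u` in `G(d) - T(d)`, i.e. `d u` minus the number of tree edges at
`u`, determined by the execution path `E` alone. -/
noncomputable def minusDeg {n : ℕ} {d : Fin n → ℕ} (E : Path d) (u : Fin n) : ℕ :=
  d u - cc E u - (if IsNonRootV E u then 1 else 0)

/-- `Aⁿ(k,ℓ)`: the number of non-root vertices `u` of the tree built by `E` with
`d₋(u) = k` and `d₋(parent(u)) = ℓ`. -/
noncomputable def Acount {n : ℕ} {d : Fin n → ℕ} (E : Path d) (k l : ℕ) : ℕ :=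
  Nat.card {u : Fin n // IsNonRootV E u ∧ minusDeg E u = k ∧
    minusDeg E (parentOf E u) = l}


section PartA
variable {V : Type*} [Fintype V] [DecidableEq V]

def upd {t : ℕ} (Q : Fin (t+1) → V) (x : V) : Fin t → V :=
  fun j => if Q j.succ = x then Q 0 else Q j.succ

def Val : (t : ℕ) → Finset V → (Fin t → V) → (Fin t → V) → Prop
  | 0, _, _, _ => True
  | t+1, R, Q, r => r 0 ∈ R ∧ r 0 ≠ Q 0 ∧
      Val t (R.erase (r 0)) (upd Q (r 0)) (fun j => r j.succ)

lemma val_sum (t : ℕ) (R : Finset V) (Q : Fin (t+1) → V) (ψ : (Fin (t+1) → V) → ℝ) :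
    ∑ r ∈ Finset.univ.filter (Val (t+1) R Q), ψ r
      = ∑ x ∈ R.erase (Q 0), ∑ r ∈ Finset.univ.filter (Val t (R.erase x) (upd Q x)),
          ψ (Fin.cons x r) := by
  rw [Finset.sum_filter, ← (Fin.consEquiv (fun _ : Fin (t+1) => V)).sum_comp, Fintype.sum_prod_type]
  have : R.erase (Q 0) = Finset.univ.filter (fun x => x ∈ R ∧ x ≠ Q 0) := by
    ext x; simp [and_comm]
  rw [this, Finset.sum_filter]
  refine Finset.sum_congr rfl fun x _ => ?_
  by_cases hx : x ∈ R ∧ x ≠ Q 0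
  · rw [if_pos hx, Finset.sum_filter]
    refine Finset.sum_congr rfl fun r _ => ?_
    simp only [Fin.consEquiv_apply, Val, Fin.cons_zero, Fin.cons_succ]
    simp only [hx.1, ne_eq, hx.2, not_false_eq_true, true_and]
    rfl
  · rw [if_neg hx]
    refine Finset.sum_eq_zero fun r _ => ?_
    rw [if_neg]
    simp only [Fin.consEquiv_apply, Val, Fin.cons_zero]
    tauto

lemma upd_mem {t : ℕ} {R : Finset V} {Q : Fin (t+1) → V} (hQ : ∀ j, Q j ∈ R) {x : V}
    (hx : x ∈ R.erase (Q 0)) (j : Fin t) : upd Q x j ∈ R.erase x := by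
  have h0 := hQ 0
  have h1 := hQ j.succ
  simp only [upd, Finset.mem_erase] at *
  split_ifs with h
  · exact ⟨fun h => hx.1 h.symm, h0⟩
  · exact ⟨h, h1⟩

lemma cnt0 (t : ℕ) : ∀ (R : Finset V) (Q : Fin t → V), (∀ j, Q j ∈ R) → R.card = t + 1 →
    ∑ r ∈ Finset.univ.filter (Val t R Q), (1:ℝ) = t.factorial := by
  induction t with
  | zero => intro R Q _ _; simp [Val]
  | succ t ih =>
    intro R Q hQ hR
    rw [val_sum]
    rw [Finset.sum_congr rfl (g := fun _ => (t.factorial : ℝ))]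
    · rw [Finset.sum_const, Finset.card_erase_of_mem (hQ 0), hR, Nat.factorial_succ]
      simp
    · intro x hx
      apply ih _ _ (upd_mem hQ hx)
      rw [Finset.card_erase_of_mem (Finset.mem_of_mem_erase hx), hR]; rfl

lemma val_mem (t : ℕ) : ∀ (R : Finset V) (Q r : Fin t → V), Val t R Q r → ∀ j, r j ∈ R := by
  induction t with
  | zero => intro R Q r _ j; exact j.elim0
  | succ t ih =>
    intro R Q r h j
    obtain ⟨h1, h2, h3⟩ := h
    refine Fin.cases h1 (fun j => ?_) j
    exact Finset.mem_of_mem_erase (ih _ _ _ h3 j)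

lemma val_inj (t : ℕ) : ∀ (R : Finset V) (Q r : Fin t → V), Val t R Q r →
    Function.Injective r := by
  induction t with
  | zero => intro R Q r _ j; exact j.elim0
  | succ t ih =>
    intro R Q r h
    obtain ⟨h1, h2, h3⟩ := h
    have key : ∀ j : Fin t, r j.succ ≠ r 0 := fun j =>
      Finset.ne_of_mem_erase (val_mem _ _ _ _ h3 j)
    intro i j
    refine Fin.cases ?_ (fun i => ?_) i <;> refine Fin.cases ?_ (fun j => ?_) j
    · simp
    · intro h; exact absurd h.symm (key j)
    · intro h; exact absurd h (key i)
    · intro h; exact congrArg _ (ih _ _ _ h3 h)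

lemma cnt1 (t : ℕ) : ∀ (R : Finset V) (Q : Fin (t+1) → V), (∀ j, Q j ∈ R) → R.card = t + 2 →
    ∀ (j : Fin (t+1)) (u : V), u ∈ R →
    ∑ r ∈ Finset.univ.filter (Val (t+1) R Q), (if r j = u then (1:ℝ) else 0)
      = if Q j = u then 0 else (t.factorial : ℝ) := by
  induction t with
  | zero =>
    intro R Q hQ hR j u hu
    rw [val_sum]
    have : j = 0 := Fin.ext (by have := j.2; omega)
    subst this
    simp [Val]
    grind
  | succ t ih =>
    intro R Q hQ hR j u hu
    rw [val_sum]
    have hcard : ∀ x ∈ R.erase (Q 0), (R.erase x).card = t + 2 := by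
      intro x hx
      rw [Finset.card_erase_of_mem (Finset.mem_of_mem_erase hx), hR]; rfl
    refine Fin.cases ?_ (fun j => ?_) j
    · simp only [Fin.cons_zero]
      have : ∀ x ∈ R.erase (Q 0), ∑ r ∈ Finset.univ.filter (Val (t+1) (R.erase x) (upd Q x)),
          (if x = u then (1:ℝ) else 0) = if x = u then ((t+1).factorial : ℝ) else 0 := by
        intro x hx
        split_ifs with h
        · exact cnt0 _ _ _ (upd_mem hQ hx) (hcard x hx)
        · simp
      rw [Finset.sum_congr rfl this, Finset.sum_ite_eq']
      by_cases h : Q 0 = u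
      · simp [h]
      · rw [if_pos, if_neg h]; simp [hu, Ne.symm h]
    · simp only [Fin.cons_succ]
      have : ∀ x ∈ R.erase (Q 0), ∑ r ∈ Finset.univ.filter (Val (t+1) (R.erase x) (upd Q x)),
          (if r j = u then (1:ℝ) else 0)
          = if x ≠ u ∧ upd Q x j ≠ u then (t.factorial : ℝ) else 0 := by
        intro x hx
        by_cases hxu : x = u
        · rw [if_neg (by tauto)]
          refine Finset.sum_eq_zero fun r hr => ?_
          rw [if_neg]
          have := val_mem _ _ _ _ (Finset.mem_filter.1 hr).2 j
          intro h
          simp [h, hxu] at this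
        · rw [ih _ _ (upd_mem hQ hx) (hcard x hx) j u (by simp [hu, Ne.symm hxu])]
          by_cases h : upd Q x j = u <;> simp [h, hxu]
      rw [Finset.sum_congr rfl this, ← Finset.sum_filter, Finset.sum_const]
      by_cases h : Q j.succ = u
      · rw [if_pos h, Finset.filter_eq_empty_iff.2]
        · simp
        · intro x hx; simp [upd]; grind
      · rw [if_neg h]
        have : (Finset.filter (fun x => x ≠ u ∧ upd Q x j ≠ u) (R.erase (Q 0))).card = t + 1 := by
          by_cases h0 : Q 0 = u
          · have : (Finset.filter (fun x => x ≠ u ∧ upd Q x j ≠ u) (R.erase (Q 0)))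
              = (R.erase (Q 0)).erase (Q j.succ) := by
              ext x; simp only [upd, Finset.mem_filter, Finset.mem_erase]; grind
            rw [this, Finset.card_erase_of_mem, Finset.card_erase_of_mem (hQ 0), hR]
            · rfl
            · simp [hQ, h0, h]
          · have : (Finset.filter (fun x => x ≠ u ∧ upd Q x j ≠ u) (R.erase (Q 0)))
              = (R.erase (Q 0)).erase u := by
              ext x; simp only [upd, Finset.mem_filter, Finset.mem_erase]; grind
            rw [this, Finset.card_erase_of_mem, Finset.card_erase_of_mem (hQ 0), hR]
            · rfl
            · simp [hu, Ne.symm h0]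
        rw [this, Nat.factorial_succ]; simp

lemma cnt2 (t : ℕ) : ∀ (R : Finset V) (Q : Fin (t+2) → V), (∀ j, Q j ∈ R) → R.card = t + 3 →
    ∀ (i j : Fin (t+2)) (u w : V), i < j → u ∈ R → w ∈ R → u ≠ w →
    ∑ r ∈ Finset.univ.filter (Val (t+2) R Q), (if r i = u ∧ r j = w then (1:ℝ) else 0)
      ≤ if Q i ≠ u ∧ Q j ≠ w ∧ ¬ (Q i = w ∧ Q j = u) then (t.factorial : ℝ) else 0 := by
  induction t with
  | zero =>
    intro R Q hQ hR i j u w hij hu hw huw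
    have hi : i = 0 := Fin.ext (by have := j.2; have : i.1 < j.1 := hij; simp; omega)
    have hj : j = Fin.succ 0 := Fin.ext (by have := j.2; have : i.1 < j.1 := hij; simp; omega)
    subst hi; subst hj
    rw [val_sum]
    have : ∀ x ∈ R.erase (Q 0), ∑ r ∈ Finset.univ.filter (Val (0+1) (R.erase x) (upd Q x)),
          (if (Fin.cons x r : Fin (0+2) → V) 0 = u ∧ (Fin.cons x r : Fin (0+2) → V) (Fin.succ 0) = w
            then (1:ℝ) else 0)
          = if x = u then (if upd Q x 0 = w then 0 else 1) else 0 := by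
      intro x hx
      simp only [Fin.cons_zero, Fin.cons_succ]
      by_cases hxu : x = u
      · simp only [hxu, true_and, if_true]
        subst hxu
        rw [cnt1 0 _ _ (upd_mem hQ hx) _ 0 w (by simp [hw, Ne.symm huw])]
        · simp
        · rw [Finset.card_erase_of_mem (Finset.mem_of_mem_erase hx), hR]
      · simp [hxu]
    rw [Finset.sum_congr rfl this, Finset.sum_ite_eq']
    simp only [upd, Finset.mem_erase]
    split_ifs <;> first | (norm_num; done) | (exfalso; grind)
  | succ t ih =>
    intro R Q hQ hR i j u w hij hu hw huw
    have hcard : ∀ x ∈ R.erase (Q 0), (R.erase x).card = t + 3 := by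
      intro x hx
      rw [Finset.card_erase_of_mem (Finset.mem_of_mem_erase hx), hR]; rfl
    obtain ⟨j, rfl⟩ : ∃ j', j = Fin.succ j' := Fin.exists_succ_eq.2 (by rintro rfl; simp at hij) |>.imp fun _ h => h.symm
    rw [val_sum]
    revert hij
    refine Fin.cases ?_ (fun i => ?_) i <;> intro hij
    · have : ∀ x ∈ R.erase (Q 0), ∑ r ∈ Finset.univ.filter (Val (t+1+1) (R.erase x) (upd Q x)),
          (if (Fin.cons x r : Fin (t+1+2) → V) 0 = u ∧ (Fin.cons x r : Fin (t+1+2) → V) (Fin.succ j) = w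
            then (1:ℝ) else 0)
          = if x = u then (if upd Q x j = w then 0 else ((t+1).factorial : ℝ)) else 0 := by
        intro x hx
        simp only [Fin.cons_zero, Fin.cons_succ]
        by_cases hxu : x = u
        · simp only [hxu, true_and, if_true]
          subst hxu
          rw [cnt1 (t+1) _ _ (upd_mem hQ hx) (hcard x hx) j w (by simp [hw, Ne.symm huw])]
        · simp [hxu]
      rw [Finset.sum_congr rfl this, Finset.sum_ite_eq']
      simp only [upd, Finset.mem_erase]
      split_ifs <;> first | exact le_rfl | positivity | (exfalso; grind)
    · simp only [Fin.cons_succ]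
      have hij' : i < j := by simpa using hij
      have : ∀ x ∈ R.erase (Q 0), ∑ r ∈ Finset.univ.filter (Val (t+2) (R.erase x) (upd Q x)),
          (if r i = u ∧ r j = w then (1:ℝ) else 0)
          ≤ if x ≠ u ∧ x ≠ w ∧ upd Q x i ≠ u ∧ upd Q x j ≠ w ∧ ¬ (upd Q x i = w ∧ upd Q x j = u)
            then (t.factorial : ℝ) else 0 := by
        intro x hx
        by_cases hxu : x ≠ u ∧ x ≠ w
        · have := ih _ _ (upd_mem hQ hx) (hcard x hx) i j u w hij' (by simp [hu, Ne.symm hxu.1])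
            (by simp [hw, Ne.symm hxu.2]) huw
          refine this.trans (le_of_eq ?_)
          simp only [hxu.1, hxu.2, ne_eq, not_false_eq_true, true_and]
        · rw [if_neg (by tauto)]
          refine le_of_eq (Finset.sum_eq_zero fun r hr => ?_)
          rw [if_neg]
          have h1 := val_mem _ _ _ _ (Finset.mem_filter.1 hr).2 j
          have h2 := val_mem _ _ _ _ (Finset.mem_filter.1 hr).2 i
          rintro ⟨rfl, rfl⟩
          simp at h1 h2
          tauto
      refine (Finset.sum_le_sum this).trans ?_
      rw [← Finset.sum_filter, Finset.sum_const, nsmul_eq_mul]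
      set B := Finset.filter (fun x => x ≠ u ∧ x ≠ w ∧ upd Q x i ≠ u ∧ upd Q x j ≠ w ∧
        ¬ (upd Q x i = w ∧ upd Q x j = u)) (R.erase (Q 0)) with hB
      by_cases h : Q i.succ ≠ u ∧ Q j.succ ≠ w ∧ ¬ (Q i.succ = w ∧ Q j.succ = u)
      · rw [if_pos h]
        have : ∃ C : Finset V, C ⊆ R ∧ C.card = 3 ∧ B ⊆ R \ C := by
          by_cases h0 : Q 0 = u
          · by_cases h1 : Q i.succ = w
            · refine ⟨{u, w, Q j.succ}, ?_, ?_, ?_⟩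
              · intro x; simp; grind
              · exact Finset.card_eq_three.2 ⟨_, _, _, by grind, by grind, by grind, rfl⟩
              · intro x hx; simp only [hB, upd, Finset.mem_filter, Finset.mem_erase] at hx; simp; grind
            · refine ⟨{u, w, Q i.succ}, ?_, ?_, ?_⟩
              · intro x; simp; grind
              · exact Finset.card_eq_three.2 ⟨_, _, _, by grind, by grind, by grind, rfl⟩
              · intro x hx; simp only [hB, upd, Finset.mem_filter, Finset.mem_erase] at hx; simp; grind
          · by_cases h0 : Q 0 = w
            · by_cases h1 : Q j.succ = u
              · refine ⟨{u, w, Q i.succ}, ?_, ?_, ?_⟩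
                · intro x; simp; grind
                · exact Finset.card_eq_three.2 ⟨_, _, _, by grind, by grind, by grind, rfl⟩
                · intro x hx; simp only [hB, upd, Finset.mem_filter, Finset.mem_erase] at hx; simp; grind
              · refine ⟨{u, w, Q j.succ}, ?_, ?_, ?_⟩
                · intro x; simp; grind
                · exact Finset.card_eq_three.2 ⟨_, _, _, by grind, by grind, by grind, rfl⟩
                · intro x hx; simp only [hB, upd, Finset.mem_filter, Finset.mem_erase] at hx; simp; grind
            · refine ⟨{u, w, Q 0}, ?_, ?_, ?_⟩
              · intro x; simp; grind
              · exact Finset.card_eq_three.2 ⟨_, _, _, by grind, by grind, by grind, rfl⟩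
              · intro x hx; simp only [hB, upd, Finset.mem_filter, Finset.mem_erase] at hx; simp; grind
        obtain ⟨C, hC, hC3, hBC⟩ := this
        have h2 := Finset.card_le_card hBC
        rw [Finset.card_sdiff_of_subset hC, hR, hC3] at h2
        rw [Nat.factorial_succ]; push_cast
        have : (B.card : ℝ) ≤ t + 1 := by exact_mod_cast h2
        gcongr
      · rw [if_neg h, hB, Finset.filter_eq_empty_iff.2]
        · simp
        · intro x hx
          simp only [upd]; grind

end PartA


section PartA2
variable {V : Type*} [Fintype V] [DecidableEq V]

lemma sum_at {ι : Type*} (Ω : Finset ι) (ρ : ι → V) (f : V → ℝ) :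
    ∑ r ∈ Ω, f (ρ r) = ∑ u, f u * ∑ r ∈ Ω, (if ρ r = u then (1:ℝ) else 0) := by
  simp_rw [Finset.mul_sum]
  rw [Finset.sum_comm]
  refine Finset.sum_congr rfl fun r _ => ?_
  simp

lemma mom1 (t : ℕ) (hV : Fintype.card V = t + 2) (Q : Fin (t+1) → V) (f : V → ℝ)
    (g : Fin (t+1) → ℝ) :
    ∑ r ∈ Finset.univ.filter (Val (t+1) Finset.univ Q), ∑ j, f (r j) * g j
      = t.factorial * ∑ j, g j * (∑ u, f u - f (Q j)) := by
  rw [Finset.sum_comm, Finset.mul_sum]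
  refine Finset.sum_congr rfl fun j _ => ?_
  rw [← Finset.sum_mul, sum_at _ (fun r : Fin (t+1) → V => r j)]
  have : ∀ u ∈ (Finset.univ : Finset V), f u * ∑ r ∈ Finset.univ.filter (Val (t+1) Finset.univ Q),
      (if r j = u then (1:ℝ) else 0) = f u * t.factorial - (if Q j = u then f u * t.factorial else 0) := by
    intro u _
    rw [cnt1 t _ _ (fun _ => Finset.mem_univ _) (by simpa using hV) j u (Finset.mem_univ _)]
    split_ifs <;> simp
  rw [Finset.sum_congr rfl this, Finset.sum_sub_distrib, ← Finset.sum_mul]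
  simp
  ring

lemma pair_le (t : ℕ) (hV : Fintype.card V = t + 3) (Q : Fin (t+2) → V) (f : V → ℝ)
    (hf : ∀ u, 0 ≤ f u) (i j : Fin (t+2)) (hij : i < j) :
    ∑ r ∈ Finset.univ.filter (Val (t+2) Finset.univ Q), f (r i) * f (r j)
      ≤ t.factorial * (∑ u, f u) ^ 2 := by
  have h1 : ∀ r ∈ Finset.univ.filter (Val (t+2) Finset.univ Q), f (r i) * f (r j)
      = ∑ u, ∑ w, f u * f w * (if r i = u ∧ r j = w then (1:ℝ) else 0) := by
    intro r _
    rw [Finset.sum_eq_single (r i), Finset.sum_eq_single (r j)]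
    · simp
    · intro w _ hw; simp [Ne.symm hw]
    · simp
    · intro u _ hu; simp [Ne.symm hu]
    · simp
  rw [Finset.sum_congr rfl h1, Finset.sum_comm, pow_two, Finset.sum_mul_sum, Finset.mul_sum]
  refine Finset.sum_le_sum fun u _ => ?_
  rw [Finset.sum_comm, Finset.mul_sum]
  refine Finset.sum_le_sum fun w _ => ?_
  rw [← Finset.mul_sum, mul_comm]
  refine mul_le_mul_of_nonneg_right ?_ (mul_nonneg (hf _) (hf _))
  by_cases huw : u = w
  · subst huw
    rw [Finset.sum_eq_zero]
    · positivity
    · intro r hr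
      rw [if_neg]
      rintro ⟨h1, h2⟩
      exact hij.ne (val_inj _ _ _ _ (Finset.mem_filter.1 hr).2 (h1.trans h2.symm))
  · refine (cnt2 t _ _ (fun _ => Finset.mem_univ _) (by simpa using hV) i j u w hij
      (Finset.mem_univ _) (Finset.mem_univ _) huw).trans ?_
    split_ifs <;> first | exact le_rfl | positivity

lemma mom2 (t : ℕ) (hV : Fintype.card V = t + 3) (Q : Fin (t+2) → V) (f : V → ℝ)
    (hf : ∀ u, 0 ≤ f u) (g : Fin (t+2) → ℝ) (hg : ∀ j, 0 ≤ g j) :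
    ∑ r ∈ Finset.univ.filter (Val (t+2) Finset.univ Q), (∑ j, f (r j) * g j) ^ 2
      ≤ (t+1).factorial * (∑ j, g j ^ 2) * (∑ u, f u ^ 2)
        + t.factorial * (∑ j, g j) ^ 2 * (∑ u, f u) ^ 2 := by
  have h1 : ∀ i j, ∑ r ∈ Finset.univ.filter (Val (t+2) Finset.univ Q), f (r i) * f (r j)
      ≤ (if i = j then (t+1).factorial * (∑ u, f u ^ 2) else 0) + t.factorial * (∑ u, f u) ^ 2 := by
    intro i j
    rcases lt_trichotomy i j with h | h | h
    · rw [if_neg h.ne, zero_add]; exact pair_le t hV Q f hf i j h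
    · subst h
      rw [if_pos rfl]
      have : ∑ r ∈ Finset.univ.filter (Val (t+2) Finset.univ Q), f (r i) * f (r i)
          ≤ (t+1).factorial * (∑ u, f u ^ 2) := by
        rw [sum_at _ (fun r : Fin (t+2) → V => r i) (fun u => f u * f u), Finset.mul_sum]
        refine Finset.sum_le_sum fun u _ => ?_
        rw [cnt1 (t+1) _ _ (fun _ => Finset.mem_univ _) (by simpa using hV) i u (Finset.mem_univ _)]
        split_ifs
        · simp; positivity
        · apply le_of_eq; ring
      have h2 : 0 ≤ (t.factorial : ℝ) * (∑ u, f u) ^ 2 := by positivity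
      linarith
    · rw [if_neg h.ne', zero_add]
      refine le_of_eq_of_le (Finset.sum_congr rfl fun r _ => mul_comm _ _) (pair_le t hV Q f hf j i h)
  have h2 : ∑ r ∈ Finset.univ.filter (Val (t+2) Finset.univ Q), (∑ j, f (r j) * g j) ^ 2
      = ∑ i, ∑ j, (g i * g j) * ∑ r ∈ Finset.univ.filter (Val (t+2) Finset.univ Q), f (r i) * f (r j) := by
    simp_rw [pow_two, Finset.sum_mul_sum, Finset.mul_sum]
    rw [Finset.sum_comm]
    refine Finset.sum_congr rfl fun i _ => ?_
    rw [Finset.sum_comm]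
    refine Finset.sum_congr rfl fun j _ => Finset.sum_congr rfl fun r _ => ?_
    ring
  rw [h2]
  refine (Finset.sum_le_sum fun i _ => Finset.sum_le_sum fun j _ =>
    mul_le_mul_of_nonneg_left (h1 i j) (mul_nonneg (hg i) (hg j))).trans (le_of_eq ?_)
  simp_rw [mul_add, Finset.sum_add_distrib]
  congr 1
  · simp only [mul_ite, mul_zero, Finset.sum_ite_eq, Finset.mem_univ, if_true]
    rw [← Finset.sum_mul]
    simp_rw [← pow_two]
    ring
  · simp_rw [← Finset.sum_mul, ← Finset.sum_mul_sum]
    ring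

lemma var_bound (t : ℕ) (hV : Fintype.card V = t + 3) (Q : Fin (t+2) → V) (f : V → ℝ)
    (hf : ∀ u, 0 ≤ f u) (hf1 : ∀ u, f u ≤ 1) (g : Fin (t+2) → ℝ) (hg : ∀ j, 0 ≤ g j)
    (hg1 : ∀ j, g j ≤ 1) :
    ∑ r ∈ Finset.univ.filter (Val (t+2) Finset.univ Q),
      (∑ j, f (r j) * g j - (∑ u, f u) * (∑ j, g j) / (t+2)) ^ 2
      ≤ ((t+2).factorial : ℝ) * (3 * ((t:ℝ)+3) + ((t:ℝ)+3)^2 / ((t:ℝ)+1)) := by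
  set F := ∑ u, f u with hF
  set G := ∑ j, g j with hG
  have hF0 : 0 ≤ F := Finset.sum_nonneg fun u _ => hf u
  have hG0 : 0 ≤ G := Finset.sum_nonneg fun u _ => hg u
  have hF1 : F ≤ t + 3 := by
    have := Finset.sum_le_sum (fun u (_ : u ∈ Finset.univ) => hf1 u)
    simp [hV] at this; linarith
  have hG1 : G ≤ t + 2 := by
    have := Finset.sum_le_sum (fun u (_ : u ∈ Finset.univ) => hg1 u)
    simp at this; linarith
  have m2 := mom2 t hV Q f hf g hg
  have m1 := mom1 (t+1) (by simpa using hV) Q f g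
  have m0 := cnt0 (t+2) Finset.univ Q (fun _ => Finset.mem_univ _) (by simpa using hV)
  have hf2 : ∑ u, f u ^ 2 ≤ F := Finset.sum_le_sum fun u _ => by nlinarith [hf u, hf1 u]
  have hg2 : ∑ j, g j ^ 2 ≤ G := Finset.sum_le_sum fun u _ => by nlinarith [hg u, hg1 u]
  have hd : ∑ j, g j * (F - f (Q j)) = G * F - ∑ j, g j * f (Q j) := by
    simp_rw [mul_sub, Finset.sum_sub_distrib, ← Finset.sum_mul]
    rfl
  have hdiag : ∑ j, g j * f (Q j) ≤ G := Finset.sum_le_sum fun j _ => by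
    nlinarith [hg j, hf1 (Q j)]
  rw [← hF, hd] at m1
  set dg := ∑ j, g j * f (Q j) with hdg
  have hdg0 : 0 ≤ dg := Finset.sum_nonneg fun j _ => mul_nonneg (hg _) (hf _)
  set Ω := Finset.univ.filter (Val (t+2) Finset.univ Q)
  have exp : ∑ r ∈ Ω, (∑ j, f (r j) * g j - F * G / (t+2)) ^ 2
      = ∑ r ∈ Ω, (∑ j, f (r j) * g j)^2 - 2 * (F * G / (t+2)) * ∑ r ∈ Ω, (∑ j, f (r j) * g j)
        + (F * G / (t+2))^2 * ∑ r ∈ Ω, (1:ℝ) := by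
    generalize F * G / ((t:ℝ)+2) = c
    rw [Finset.mul_sum, Finset.mul_sum, ← Finset.sum_sub_distrib, ← Finset.sum_add_distrib]
    refine Finset.sum_congr rfl fun r _ => ?_
    ring
  rw [exp, m0]
  have m1' : ∑ r ∈ Ω, (∑ j, f (r j) * g j) = (t+1).factorial * (G * F - dg) := m1
  rw [m1']
  have e2 : ((t+2).factorial : ℝ) = (t+2) * ((t+1) * t.factorial) := by
    rw [Nat.factorial_succ, Nat.factorial_succ]; push_cast; ring
  have e1 : ((t+1).factorial : ℝ) = ((t+1) * t.factorial) := by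
    rw [Nat.factorial_succ]; push_cast; ring
  rw [e1, ← hG] at m2
  rw [e1, e2]
  have hp : (0:ℝ) < t.factorial := by positivity
  set P := (t.factorial : ℝ)
  have ht : (0:ℝ) ≤ t := by positivity
  have hgf : (∑ j, g j ^ 2) * (∑ u, f u ^ 2) ≤ G * F := by
    apply mul_le_mul hg2 hf2 _ hG0
    exact Finset.sum_nonneg fun u _ => by positivity
  have m2' : ∑ r ∈ Ω, (∑ j, f (r j) * g j) ^ 2 ≤ (t+1) * P * (G * F) + P * G^2 * F^2 := by
    refine m2.trans ?_
    have := mul_le_mul_of_nonneg_left hgf (by positivity : (0:ℝ) ≤ (t+1) * P)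
    nlinarith [this]
  have a1 : G * F ≤ (t+2) * (t+3) := mul_le_mul hG1 hF1 hF0 (by positivity)
  have key : (t+1) * P * (G * F) + P * G^2 * F^2 - 2 * (F * G / (t+2)) * ((t+1) * P * (G * F - dg))
        + (F * G / (t+2))^2 * ((t+2) * ((t+1) * P))
      = P * ((t+1) * (G*F) + (G*F)^2/(t+2) + 2 * (t+1) * (G*F) * dg / (t+2)) := by
    field_simp
    ring
  have b1 : (t+1) * (G*F) ≤ (t+1) * ((t+2) * (t+3)) := by gcongr
  have b2 : (G*F)^2/(t+2) ≤ ((t+2)*(t+3))^2/(t+2) := by gcongr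
  have b3 : 2 * (t+1) * (G*F) * dg / (t+2) ≤ 2 * (t+1) * ((t+2)*(t+3)) * (t+2) / (t+2) := by
    gcongr
    linarith
  calc _ ≤ (t+1) * P * (G * F) + P * G^2 * F^2 - 2 * (F * G / (t+2)) * ((t+1) * P * (G * F - dg))
        + (F * G / (t+2))^2 * ((t+2) * ((t+1) * P)) := by linarith
    _ = _ := key
    _ ≤ P * ((t+1) * ((t+2) * (t+3)) + ((t+2)*(t+3))^2/(t+2) + 2 * (t+1) * ((t+2)*(t+3)) * (t+2) / (t+2)) := by
        gcongr
    _ = _ := by field_simp; ring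

end PartA2


section PartB
variable {V : Type*} [Fintype V] [DecidableEq V]

def STrel {t : ℕ} (c : V → V) (r q : Fin t → V) (k : Fin t) (x y : V) : Prop :=
  c x = c y ∨ ∃ j, j < k ∧ ((r j = x ∧ q j = y) ∨ (r j = y ∧ q j = x))

lemma STrel_symm {t : ℕ} (c : V → V) (r q : Fin t → V) (k : Fin t) : Std.Symm (STrel c r q k) := by
  refine ⟨fun x y h => ?_⟩
  rcases h with h | ⟨j, hj, h⟩
  · exact Or.inl h.symm
  · exact Or.inr ⟨j, hj, h.symm⟩

lemma RT_mono {α : Type*} {p q : α → α → Prop} (h : ∀ x y, p x y → Relation.ReflTransGen q x y) {a b : α}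
    (hab : Relation.ReflTransGen p a b) : Relation.ReflTransGen q a b := by
  induction hab with
  | refl => exact .refl
  | tail _ h2 ih => exact ih.trans (h _ _ h2)

lemma val_iff (t : ℕ) : ∀ (R : Finset V) (c : V → V) (r q : Fin t → V),
    (∀ x, c x ∈ R) → (∀ x ∈ R, c x = x) →
    (Val t R (fun j => c (q j)) r ↔ ∀ k, r k ∈ R ∧ (∀ j, j < k → r j ≠ r k) ∧
      ¬ Relation.ReflTransGen (STrel c r q k) (r k) (q k)) := by
  induction t with
  | zero => intro R c r q _ _; simp [Val]
  | succ t ih =>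
    intro R c r q hc hR
    rw [Fin.forall_fin_succ]
    have h0 : Relation.ReflTransGen (STrel c r q 0) (r 0) (q 0) ↔ c (r 0) = c (q 0) := by
      constructor
      · intro h
        generalize q 0 = y at h
        induction h with
        | refl => rfl
        | tail _ h2 ih2 =>
          rcases h2 with h2 | ⟨j, hj, _⟩
          · exact ih2.trans h2
          · exact absurd hj (by simp)
      · intro h; exact .single (Or.inl h)
    have h0' : (r 0 ∈ R ∧ (∀ j, j < 0 → r j ≠ r 0) ∧
      ¬ Relation.ReflTransGen (STrel c r q 0) (r 0) (q 0)) ↔ (r 0 ∈ R ∧ r 0 ≠ c (q 0)) := by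
      rw [h0]
      constructor
      · rintro ⟨h1, _, h2⟩; rw [hR _ h1] at h2; exact ⟨h1, h2⟩
      · rintro ⟨h1, h2⟩; refine ⟨h1, by simp, ?_⟩; rwa [hR _ h1]
    rw [h0']
    simp only [Val]
    rw [← and_assoc]
    refine and_congr_right fun ⟨h1, h2⟩ => ?_
    have hc0 := hR _ h1
    set c' : V → V := fun x => if c x = r 0 then c (q 0) else c x with hc'
    have hu : upd (fun j => c (q j)) (r 0) = fun j : Fin t => c' (q j.succ) := rfl
    rw [hu, ih (R.erase (r 0)) c' (fun j => r j.succ) (fun j => q j.succ)]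
    · refine forall_congr' fun k => ?_
      have e1 : (∀ j, j < k.succ → r j ≠ r k.succ) ↔ r 0 ≠ r k.succ ∧
          ∀ j : Fin t, j < k → r j.succ ≠ r k.succ := by
        rw [Fin.forall_fin_succ]
        simp
      have cc : ∀ x, c (c x) = c x := fun x => hR _ (hc x)
      have e2 : Relation.ReflTransGen (STrel c r q k.succ) (r k.succ) (q k.succ) ↔
          Relation.ReflTransGen (STrel c' (fun j => r j.succ) (fun j => q j.succ) k)
            (r k.succ) (q k.succ) := by
        constructor
        · apply RT_mono
          intro x y h
          apply Relation.ReflTransGen.single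
          rcases h with h | ⟨j, hj, h⟩
          · left; simp only [hc', h]
          · revert hj h
            refine Fin.cases ?_ (fun j => ?_) j
            · intro _ h
              left
              have : c' (r 0) = c' (q 0) := by simp only [hc']; grind
              rcases h with ⟨rfl, rfl⟩ | ⟨rfl, rfl⟩
              · exact this
              · exact this.symm
            · intro hj h
              exact Or.inr ⟨j, by simpa using hj, h⟩
        · apply RT_mono
          intro x y h
          have key : ∀ x, Relation.ReflTransGen (STrel c r q k.succ) x (c' x) := by
            intro x
            simp only [hc']
            split_ifs with hx
            · have s1 : STrel c r q k.succ x (r 0) := Or.inl (by rw [hc0, hx])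
              have s2 : STrel c r q k.succ (r 0) (q 0) :=
                Or.inr ⟨0, by simp, Or.inl ⟨rfl, rfl⟩⟩
              have s3 : STrel c r q k.succ (q 0) (c (q 0)) := Or.inl (cc _).symm
              exact ((Relation.ReflTransGen.single s1).tail s2).tail s3
            · exact .single (Or.inl (cc _).symm)
          rcases h with h | ⟨j, hj, h⟩
          · have k2 := key y
            rw [← h] at k2
            have := STrel_symm c r q k.succ
            exact (key x).trans (Relation.ReflTransGen.symmetric.symm _ _ k2)
          · exact .single (Or.inr ⟨j.succ, by simpa using hj, h⟩)
      rw [e1, e2]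
      simp only [Finset.mem_erase]
      grind
    · intro x
      simp only [hc', Finset.mem_erase]
      split_ifs with h
      · exact ⟨Ne.symm h2, hc _⟩
      · exact ⟨h, hc _⟩
    · intro x hx
      obtain ⟨hx1, hx2⟩ := Finset.mem_erase.1 hx
      simp only [hc']
      rw [hR _ hx2, if_neg hx1]

end PartB

section PartB2
variable {n : ℕ} (d : Fin n → ℕ)

/-- non-root half-edges -/
abbrev NH := {h : HE d // IsNonRootHE d h}

noncomputable def rootHE (hd : ∀ i, 1 ≤ d i) (i : Fin n) : HE d := ⟨i, ⟨d i - 1, by have := hd i; omega⟩⟩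

lemma rootHE_eq (hd : ∀ i, 1 ≤ d i) (h : HE d) (hr : IsRootHE d h) : rootHE d hd h.1 = h := by
  obtain ⟨i, j⟩ := h
  simp only [IsRootHE] at hr
  simp only [rootHE]
  congr 1
  ext; exact hr.symm

noncomputable def mkE (hd : ∀ i, 1 ≤ d i) (s : Fin (n-1) ↪ NH d) (r : Fin (n-1) → Fin n) : Path d :=
  fun k => (rootHE d hd (r k), (s k).1)

lemma sameTree_iff (E : Path d) (k : Fin (n-1)) (a b : Fin n) :
    SameTree E k a b ↔ Relation.ReflTransGen (STrel id (fun k => (E k).1.1) (fun k => (E k).2.1) k) a b := by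
  constructor
  · apply RT_mono
    intro x y h
    exact .single (Or.inr h)
  · apply RT_mono
    intro x y h
    rcases h with h | h
    · simp only [id] at h; rw [h]
    · exact .single h

lemma exec_iff (hd : ∀ i, 1 ≤ d i) (E : Path d) :
    IsExecPath d E ↔ (∀ k, IsRootHE d (E k).1) ∧ (∀ k, IsNonRootHE d (E k).2) ∧
      Function.Injective (fun k => (E k).2) ∧
      Val (n-1) Finset.univ (fun k => (E k).2.1) (fun k => (E k).1.1) := by
  have hv := val_iff (n-1) Finset.univ id (fun k => (E k).1.1) (fun k => (E k).2.1)
    (fun _ => Finset.mem_univ _) (fun _ _ => rfl)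
  simp only [id] at hv
  rw [hv]
  constructor
  · intro h
    have hr : ∀ k, IsRootHE d (E k).1 := fun k => (h k).1
    refine ⟨hr, fun k => (h k).2.1, ?_, ?_⟩
    · intro i j hij
      rcases lt_trichotomy i j with h' | h' | h'
      · exact absurd hij ((h j).2.2.2.1 i h')
      · exact h'
      · exact absurd hij.symm ((h i).2.2.2.1 j h')
    · intro k
      refine ⟨Finset.mem_univ _, fun j hj he => (h k).2.2.1 j hj ?_, ?_⟩
      · rw [← rootHE_eq d hd _ (hr j), ← rootHE_eq d hd _ (hr k), he]
      · have := (h k).2.2.2.2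
        rwa [sameTree_iff] at this
  · rintro ⟨h1, h2, h3, h4⟩ k
    refine ⟨h1 k, h2 k, fun j hj he => (h4 k).2.1 j hj (by rw [he]), fun j hj he => ?_, ?_⟩
    · exact hj.ne (h3 he)
    · rw [sameTree_iff]; exact (h4 k).2.2

noncomputable def execFin : Finset (Path d) := Finset.univ.filter (IsExecPath d)

/-- the set of valid `r` for given `s`. -/
noncomputable def rset (s : Fin (n-1) ↪ NH d) : Finset (Fin (n-1) → Fin n) :=
  Finset.univ.filter (Val (n-1) Finset.univ (fun k => (s k).1.1))

lemma exec_sum (hd : ∀ i, 1 ≤ d i) (ψ : Path d → ℝ) :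
    ∑ E ∈ execFin d, ψ E = ∑ s : Fin (n-1) ↪ NH d, ∑ r ∈ rset d s, ψ (mkE d hd s r) := by
  rw [Finset.sum_sigma']
  symm
  refine Finset.sum_bij (fun x _ => mkE d hd x.1 x.2) ?_ ?_ ?_ ?_
  · rintro ⟨s, r⟩ h
    simp only [Finset.mem_sigma, Finset.mem_univ, true_and, rset, Finset.mem_filter] at h
    simp only [execFin, Finset.mem_filter, Finset.mem_univ, true_and]
    rw [exec_iff d hd]
    refine ⟨fun k => ?_, fun k => (s k).2, fun i j hij => ?_, h⟩
    · simp [mkE, rootHE, IsRootHE]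
    · exact s.injective (Subtype.ext hij)
  · rintro ⟨s, r⟩ h ⟨s', r'⟩ h' he
    have e1 : s = s' := by
      ext k : 1
      apply Subtype.ext
      exact congrArg Prod.snd (congrFun he k)
    have e2 : r = r' := by
      ext k : 1
      exact congrArg (fun x => x.1.1) (congrFun he k)
    subst e1; subst e2; rfl
  · intro E hE
    simp only [execFin, Finset.mem_filter, Finset.mem_univ, true_and] at hE
    obtain ⟨h1, h2, h3, h4⟩ := (exec_iff d hd E).1 hE
    refine ⟨⟨⟨fun k => ⟨(E k).2, h2 k⟩, fun i j hij => h3 (congrArg Subtype.val hij)⟩,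
      fun k => (E k).1.1⟩, ?_, ?_⟩
    · simp only [Finset.mem_sigma, Finset.mem_univ, true_and, rset, Finset.mem_filter]
      exact h4
    · funext k
      apply Prod.ext
      · exact rootHE_eq d hd _ (h1 k)
      · rfl
  · intros; rfl

end PartB2


section PartC
variable {H : Type*} [Fintype H] [DecidableEq H]

lemma emb_fiber (m : ℕ) (S : Finset H) (hS : S.card = m) :
    (Finset.univ.filter (fun s : Fin m ↪ H => Finset.univ.map s = S)).card = m.factorial := by
  have h1 : Fintype.card (Fin m ↪ S) = m.factorial := by
    rw [Fintype.card_embedding_eq]; simp [hS, Nat.descFactorial_self]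
  rw [← h1, ← Finset.card_univ]
  symm
  refine Finset.card_bij (fun s _ => s.trans (Function.Embedding.subtype _)) ?_ ?_ ?_
  · intro s _
    simp only [Finset.mem_filter, Finset.mem_univ, true_and]
    apply Finset.eq_of_subset_of_card_le
    · intro x hx
      simp only [Finset.mem_map, Finset.mem_univ, true_and] at hx
      obtain ⟨k, rfl⟩ := hx
      exact (s k).2
    · simp [hS]
  · intro s _ s' _ h
    ext k
    exact congrArg (fun f => f k) h
  · intro s hs
    simp only [Finset.mem_filter, Finset.mem_univ, true_and] at hs
    refine ⟨⟨fun k => ⟨s k, by rw [← hs]; simp⟩, fun i j hij => ?_⟩, Finset.mem_univ _, ?_⟩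
    · simpa using hij
    · ext k; rfl

lemma emb_sum (m : ℕ) (φ : Finset H → ℝ) :
    ∑ s : Fin m ↪ H, φ (Finset.univ.map s)
      = m.factorial * ∑ S ∈ (Finset.univ : Finset H).powersetCard m, φ S := by
  rw [← Finset.sum_fiberwise_of_maps_to (s := Finset.univ) (t := (Finset.univ : Finset H).powersetCard m)
    (g := fun s : Fin m ↪ H => Finset.univ.map s), Finset.mul_sum]
  · refine Finset.sum_congr rfl fun S hS => ?_
    rw [Finset.sum_congr rfl (g := fun _ => φ S), Finset.sum_const, emb_fiber m S (Finset.mem_powersetCard.1 hS).2]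
    · simp
    · intro s hs; rw [(Finset.mem_filter.1 hs).2]
  · intro s _
    simp [Finset.mem_powersetCard]

lemma set_count (m a b : ℕ) (A B : Finset H) (hAB : Disjoint A B) (hab : a + b ≤ m) :
    (((Finset.univ : Finset H).powersetCard m).filter
      (fun S => (S ∩ A).card = a ∧ (S ∩ B).card = b)).card
    = A.card.choose a * B.card.choose b * (Fintype.card H - (A.card + B.card)).choose (m - (a + b)) := by
  have hc : (Fintype.card H - (A.card + B.card)) = ((A ∪ B)ᶜ).card := by
    rw [Finset.card_compl, Finset.card_union_of_disjoint hAB]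
  rw [hc, ← Finset.card_powersetCard a A, ← Finset.card_powersetCard b B,
    ← Finset.card_powersetCard (m - (a+b)) ((A ∪ B)ᶜ), ← Finset.card_product, ← Finset.card_product]
  have hd : ∀ x, x ∈ A → x ∉ B := fun x hx => Finset.disjoint_left.1 hAB hx
  have dec : ∀ S : Finset H, S.card = (S ∩ A).card + (S ∩ B).card + (S \ (A ∪ B)).card := by
    intro S
    have h1 : Disjoint (S ∩ A) (S ∩ B) := by
      rw [Finset.disjoint_left]; grind
    rw [← Finset.card_union_of_disjoint h1, ← Finset.inter_union_distrib_left,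
      Finset.card_inter_add_card_sdiff]
  refine Finset.card_nbij' (fun S => ((S ∩ A, S ∩ B), S \ (A ∪ B))) (fun x => x.1.1 ∪ x.1.2 ∪ x.2)
    ?_ ?_ ?_ ?_
  · intro S hS
    simp only [Finset.coe_filter, Finset.mem_powersetCard, Set.mem_setOf_eq] at hS
    simp only [Finset.mem_coe, Finset.mem_product, Finset.mem_powersetCard]
    have := dec S
    refine ⟨⟨⟨Finset.inter_subset_right, hS.2.1⟩, ⟨Finset.inter_subset_right, hS.2.2⟩⟩, ?_, by omega⟩
    intro x; simp
  · rintro ⟨⟨X, Y⟩, Z⟩ h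
    simp only [Finset.mem_coe, Finset.mem_product, Finset.mem_powersetCard] at h
    obtain ⟨⟨⟨h1, h2⟩, h3, h4⟩, h5, h6⟩ := h
    have h5' : ∀ x ∈ Z, x ∉ A ∧ x ∉ B := by
      intro x hx; have := h5 hx; simpa using this
    have e1 : (X ∪ Y ∪ Z) ∩ A = X := by ext x; have := hd x; have := @h1 x; have := @h3 x; have := h5' x; simp; tauto
    have e2 : (X ∪ Y ∪ Z) ∩ B = Y := by ext x; have := hd x; have := @h1 x; have := @h3 x; have := h5' x; simp; tauto
    have e3 : (X ∪ Y ∪ Z) \ (A ∪ B) = Z := by ext x; have := hd x; have := @h1 x; have := @h3 x; have := h5' x; simp; tauto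
    have := dec (X ∪ Y ∪ Z)
    rw [e1, e2, e3] at this
    simp only [Finset.coe_filter, Finset.mem_powersetCard, Set.mem_setOf_eq, e1, e2]
    refine ⟨⟨Finset.subset_univ _, by omega⟩, h2, h4⟩
  · intro S hS
    ext x; simp; tauto
  · rintro ⟨⟨X, Y⟩, Z⟩ h
    simp only [Finset.mem_coe, Finset.mem_product, Finset.mem_powersetCard] at h
    obtain ⟨⟨⟨h1, h2⟩, h3, h4⟩, h5, h6⟩ := h
    have h5' : ∀ x ∈ Z, x ∉ A ∧ x ∉ B := by
      intro x hx; have := h5 hx; simpa using this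
    have e1 : (X ∪ Y ∪ Z) ∩ A = X := by ext x; have := hd x; have := @h1 x; have := @h3 x; have := h5' x; simp; tauto
    have e2 : (X ∪ Y ∪ Z) ∩ B = Y := by ext x; have := hd x; have := @h1 x; have := @h3 x; have := h5' x; simp; tauto
    have e3 : (X ∪ Y ∪ Z) \ (A ∪ B) = Z := by ext x; have := hd x; have := @h1 x; have := @h3 x; have := h5' x; simp; tauto
    simp only [e1, e2, e3]

lemma emb_count (m a b : ℕ) (A B : Finset H) (hAB : Disjoint A B) (hab : a + b ≤ m) :
    ∑ s : Fin m ↪ H, (if ((Finset.univ.map s) ∩ A).card = a ∧ ((Finset.univ.map s) ∩ B).card = b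
      then (1:ℝ) else 0)
    = m.factorial * (A.card.choose a * B.card.choose b *
        (Fintype.card H - (A.card + B.card)).choose (m - (a + b)) : ℕ) := by
  rw [emb_sum m (fun S => if (S ∩ A).card = a ∧ (S ∩ B).card = b then (1:ℝ) else 0),
    ← set_count m a b A B hAB hab, ← Finset.sum_filter]
  simp

lemma choose_identity (N m : ℕ) (hm : m ≤ N) (a b : ℕ) (ha : a ≤ m) :
    (N - (a + b)).choose (m - a) * N.descFactorial (a + b)
      = N.choose m * m.descFactorial a * (N - m).descFactorial b := by
  induction b with
  | zero =>
    simp only [Nat.add_zero, Nat.descFactorial_zero, mul_one]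
    induction a with
    | zero => simp
    | succ a ih =>
      have ih := ih (by omega)
      rw [Nat.descFactorial_succ, Nat.descFactorial_succ]
      obtain ⟨M, hM⟩ : ∃ M, N - a = M + 1 := ⟨N - a - 1, by omega⟩
      obtain ⟨j, hj⟩ : ∃ j, m - a = j + 1 := ⟨m - a - 1, by omega⟩
      have e1 : N - (a+1) = M := by omega
      have e2 : m - (a+1) = j := by omega
      rw [e1, e2, hM, hj]
      rw [hM, hj] at ih
      have := Nat.add_one_mul_choose_eq M j
      calc M.choose j * ((M+1) * N.descFactorial a) = ((M+1) * M.choose j) * N.descFactorial a := by ring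
        _ = ((M+1).choose (j+1) * N.descFactorial a) * (j+1) := by rw [this]; ring
        _ = _ := by rw [ih]; ring
  | succ b ih =>
    rw [← Nat.add_assoc, Nat.descFactorial_succ, Nat.descFactorial_succ]
    by_cases h : a + b < N
    · obtain ⟨M, hM⟩ : ∃ M, N - (a + b) = M + 1 := ⟨N - (a + b) - 1, by omega⟩
      have e1 : N - (a+b+1) = M := by omega
      rw [hM] at ih
      rw [e1, hM]
      have h2 := Nat.choose_mul_succ_eq M (m - a)
      have e3 : N - m - b = M + 1 - (m - a) := by omega
      rw [e3]
      calc M.choose (m-a) * ((M+1) * N.descFactorial (a+b)) = (M.choose (m-a) * (M+1)) * N.descFactorial (a+b) := by ring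
        _ = ((M+1).choose (m-a) * N.descFactorial (a+b)) * (M + 1 - (m - a)) := by rw [h2]; ring
        _ = _ := by rw [ih]; ring
    · have e1 : N - (a + b) = 0 := by omega
      have e2 : N - m - b = 0 := by omega
      rw [e1, e2]; simp

lemma desc_lim (x N : ℕ → ℕ) (c : ℝ) (hN : Tendsto (fun n => (N n : ℝ)) atTop atTop)
    (hx : Tendsto (fun n => (x n : ℝ) / N n) atTop (nhds c)) (b : ℕ) :
    Tendsto (fun n => ((x n).descFactorial b : ℝ) / (N n : ℝ)^b) atTop (nhds (c ^ b)) := by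
  induction b with
  | zero => simp
  | succ b ih =>
    have h0 : Tendsto (fun n => (b:ℝ) / N n) atTop (nhds 0) := hN.const_div_atTop _
    have h1 : Tendsto (fun n => (((x n - b : ℕ) : ℝ)) / N n) atTop (nhds c) := by
      refine tendsto_of_tendsto_of_tendsto_of_le_of_le (g := fun n => (x n : ℝ) / N n - b / N n)
        (by simpa using hx.sub h0) hx ?_ ?_
      · intro n
        simp only [← sub_div]
        gcongr
        rw [sub_le_iff_le_add]
        exact_mod_cast (by omega : x n ≤ x n - b + b)
      · intro n
        simp only
        gcongr
        omega
    have := h1.mul ih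
    rw [pow_succ']
    refine this.congr fun n => ?_
    rw [Nat.descFactorial_succ, pow_succ']
    push_cast
    rw [div_mul_div_comm]

lemma choose_lim (m N : ℕ → ℕ) (c : ℝ) (hmN : ∀ n, m n ≤ N n)
    (hN : Tendsto (fun n => (N n : ℝ)) atTop atTop) (hm : Tendsto m atTop atTop)
    (hx : Tendsto (fun n => (m n : ℝ) / N n) atTop (nhds c)) (a b : ℕ) :
    Tendsto (fun n => ((N n - (a + b)).choose (m n - a) : ℝ) / (N n).choose (m n)) atTop
      (nhds (c ^ a * (1 - c) ^ b)) := by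
  have h1 := desc_lim m N c hN hx a
  have hone : Tendsto (fun n => (N n : ℝ) / N n) atTop (nhds 1) := by
    refine (tendsto_const_nhds (x := (1:ℝ))).congr' ?_
    filter_upwards [hN.eventually_gt_atTop 0] with n hn
    rw [div_self hn.ne']
  have h2 := desc_lim (fun n => N n - m n) N (1 - c) hN (by
    refine (hone.sub hx).congr fun n => ?_
    rw [Nat.cast_sub (hmN n), sub_div]) b
  have h3 := desc_lim N N 1 hN hone (a + b)
  have := (h1.mul h2).div h3 (by simp)
  simp only [one_pow, div_one] at this
  refine this.congr' ?_
  filter_upwards [hN.eventually_gt_atTop ((a:ℝ) + b), hm.eventually_ge_atTop a] with n hn hma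
  have hab : a + b < N n := by exact_mod_cast hn
  have id1 := choose_identity (N n) (m n) (hmN n) a b hma
  have id2 : ((N n - (a + b)).choose (m n - a) : ℝ) * (N n).descFactorial (a + b)
      = (N n).choose (m n) * (m n).descFactorial a * (N n - m n).descFactorial b := by
    exact_mod_cast id1
  have p1 : (0:ℝ) < (N n).choose (m n) := by exact_mod_cast Nat.choose_pos (hmN n)
  have p2 : (0:ℝ) < (N n).descFactorial (a + b) := by
    have : 0 < (N n).descFactorial (a+b) := Nat.pos_of_ne_zero (by rw [Ne, Nat.descFactorial_eq_zero_iff_lt]; omega)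
    exact_mod_cast this
  have p3 : (0:ℝ) < N n := lt_of_le_of_lt (by positivity) hn
  simp only [Pi.div_apply]
  rw [pow_add]
  have p4 : (0:ℝ) < (N n : ℝ)^a := by positivity
  have p5 : (0:ℝ) < (N n : ℝ)^b := by positivity
  field_simp
  linarith

end PartC


section PartR
variable (dseq : (n : ℕ) → Fin n → ℕ) (p : ℕ → ℝ)

lemma sum_split {n : ℕ} (d : Fin n → ℕ) (K : ℕ) (φ : ℕ → ℝ) :
    ∑ i, φ (d i) = ∑ k ∈ Finset.range (K+1), φ k * (Nat.card {i : Fin n // d i = k} : ℝ)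
      + ∑ i, (if K < d i then φ (d i) else 0) := by
  have h1 : ∀ k, (Nat.card {i : Fin n // d i = k} : ℝ) = ∑ i, (if d i = k then (1:ℝ) else 0) := by
    intro k
    rw [Nat.card_eq_fintype_card, Fintype.card_subtype]
    simp
  simp_rw [h1, Finset.mul_sum]
  rw [Finset.sum_comm, ← Finset.sum_add_distrib]
  refine Finset.sum_congr rfl fun i _ => ?_
  simp only [mul_ite, mul_one, mul_zero, Finset.sum_ite_eq, Finset.mem_range]
  by_cases h : K < d i
  · rw [if_neg (by omega), if_pos h]; ring
  · rw [if_pos (by omega), if_neg h]; ring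

variable {dseq p}

lemma fin_lim (hpconv : ∀ k : ℕ, Tendsto
      (fun n => (Nat.card {i : Fin n // dseq n i = k} : ℝ) / n) atTop (nhds (p k))) (φ : ℕ → ℝ) (K : ℕ) :
    Tendsto (fun n => (∑ k ∈ Finset.range (K+1), φ k * (Nat.card {i : Fin n // dseq n i = k} : ℝ)) / n)
      atTop (nhds (∑ k ∈ Finset.range (K+1), φ k * p k)) := by
  simp_rw [Finset.sum_div, mul_div_assoc]
  exact tendsto_finset_sum _ fun k _ => (hpconv k).const_mul _

lemma tail_small (hpconv : ∀ k : ℕ, Tendsto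
      (fun n => (Nat.card {i : Fin n // dseq n i = k} : ℝ) / n) atTop (nhds (p k)))
    (μ2 : ℝ) (hμ2 : HasSum (fun k : ℕ => (k : ℝ) ^ 2 * p k) μ2)
    (hμ2conv : Tendsto (fun n => (∑ i, (dseq n i : ℝ) ^ 2) / n) atTop (nhds μ2)) (δ : ℝ) (hδ : 0 < δ) :
    ∀ᶠ K in atTop, ∀ᶠ n in atTop, (∑ i, (if K < dseq n i then (dseq n i : ℝ)^2 else 0)) / n ≤ δ := by
  have h1 : Tendsto (fun K => ∑ k ∈ Finset.range (K+1), (k:ℝ)^2 * p k) atTop (nhds μ2) :=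
    hμ2.tendsto_sum_nat.comp (tendsto_add_atTop_nat 1)
  filter_upwards [h1.eventually (lt_mem_nhds (by linarith : μ2 - δ < μ2))] with K hK
  have h2 := hμ2conv.sub (fin_lim hpconv (fun k => (k:ℝ)^2) K)
  filter_upwards [h2.eventually (gt_mem_nhds (by linarith : μ2 - ∑ k ∈ Finset.range (K+1), (k:ℝ)^2 * p k < δ))]
    with n hn
  rw [← sub_div, sum_split (dseq n) K (fun k => (k:ℝ)^2), add_sub_cancel_left] at hn
  exact hn.le

lemma summable_mu1 (hpnn : ∀ k, 0 ≤ p k) (μ2 : ℝ) (hμ2 : HasSum (fun k : ℕ => (k : ℝ) ^ 2 * p k) μ2) :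
    Summable (fun k : ℕ => (k:ℝ) * p k) := by
  refine Summable.of_nonneg_of_le (fun k => mul_nonneg (by positivity) (hpnn k)) (fun k => ?_) hμ2.summable
  gcongr
  · exact hpnn k
  · exact_mod_cast Nat.le_self_pow (by norm_num) k

lemma mean_lim (hpnn : ∀ k, 0 ≤ p k) (hpconv : ∀ k : ℕ, Tendsto
      (fun n => (Nat.card {i : Fin n // dseq n i = k} : ℝ) / n) atTop (nhds (p k)))
    (μ2 : ℝ) (hμ2 : HasSum (fun k : ℕ => (k : ℝ) ^ 2 * p k) μ2)
    (hμ2conv : Tendsto (fun n => (∑ i, (dseq n i : ℝ) ^ 2) / n) atTop (nhds μ2)) :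
    Tendsto (fun n => (∑ i, (dseq n i : ℝ)) / n) atTop (nhds (mu1 p)) := by
  have h1 : Tendsto (fun K => ∑ k ∈ Finset.range (K+1), (k:ℝ) * p k) atTop (nhds (mu1 p)) :=
    (summable_mu1 hpnn μ2 hμ2).hasSum.tendsto_sum_nat.comp (tendsto_add_atTop_nat 1)
  rw [Metric.tendsto_nhds]
  intro ε hε
  rw [Metric.tendsto_nhds] at h1
  obtain ⟨K, hK1, hK2⟩ := ((h1 (ε/3) (by positivity)).and
    (tail_small hpconv μ2 hμ2 hμ2conv (ε/3) (by positivity))).exists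
  have h3 := fin_lim hpconv (fun k => (k:ℝ)) K
  rw [Metric.tendsto_nhds] at h3
  filter_upwards [hK2, h3 (ε/3) (by positivity)] with n hn1 hn2
  rw [Real.dist_eq] at *
  rw [sum_split (dseq n) K (fun k => (k:ℝ)), add_div]
  have t0 : 0 ≤ (∑ i, (if K < dseq n i then (dseq n i : ℝ) else 0)) / n := by
    apply div_nonneg _ (by positivity)
    exact Finset.sum_nonneg fun i _ => by split_ifs <;> positivity
  have t1 : (∑ i, (if K < dseq n i then (dseq n i : ℝ) else 0)) / n ≤ ε/3 := by
    refine le_trans ?_ hn1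
    gcongr with i _
    split_ifs
    · exact_mod_cast Nat.le_self_pow (by norm_num) _
    · exact le_rfl
  rw [abs_lt] at *
  constructor <;> linarith [hn2.1, hn2.2, hK1.1, hK1.2]

/-- number of non-root half-edges -/
def Nn {n : ℕ} (d : Fin n → ℕ) : ℕ := ∑ i, (d i - 1)

lemma Nn_cast {n : ℕ} (d : Fin n → ℕ) (hd : ∀ i, 1 ≤ d i) : (Nn d : ℝ) = ∑ i, (d i : ℝ) - n := by
  unfold Nn
  push_cast
  rw [Finset.sum_congr rfl (fun i _ => Nat.cast_sub (hd i))]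
  simp

lemma Nn_ge {n : ℕ} (d : Fin n → ℕ) (hd : ∀ i, 1 ≤ d i) (hge : 2 * n ≤ ∑ i, d i) : n ≤ Nn d := by
  have := Nn_cast d hd
  have h2 : (2 * n : ℝ) ≤ ∑ i, (d i : ℝ) := by exact_mod_cast hge
  have : (n:ℝ) ≤ Nn d := by linarith
  exact_mod_cast this

lemma mu1_ge (hge : ∀ n, 2 * n ≤ ∑ i, dseq n i)
    (hm : Tendsto (fun n => (∑ i, (dseq n i : ℝ)) / n) atTop (nhds (mu1 p))) : 2 ≤ mu1 p := by
  refine ge_of_tendsto hm ?_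
  filter_upwards [eventually_gt_atTop 0] with n hn
  rw [le_div_iff₀ (by exact_mod_cast hn)]
  exact_mod_cast hge n

lemma rho_lim (hd : ∀ n i, 1 ≤ dseq n i) (hge : ∀ n, 2 * n ≤ ∑ i, dseq n i)
    (hm : Tendsto (fun n => (∑ i, (dseq n i : ℝ)) / n) atTop (nhds (mu1 p))) :
    Tendsto (fun n => ((n - 1 : ℕ) : ℝ) / Nn (dseq n)) atTop (nhds (rho p)) := by
  have h2 := mu1_ge hge hm
  have h3 : Tendsto (fun n => (Nn (dseq n) : ℝ) / n) atTop (nhds (mu1 p - 1)) := by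
    refine (hm.sub_const 1).congr' ?_
    filter_upwards [eventually_gt_atTop 0] with n hn
    have : (0:ℝ) < n := by exact_mod_cast hn
    rw [Nn_cast _ (hd n)]; field_simp
  have h4 : Tendsto (fun n : ℕ => ((n - 1 : ℕ) : ℝ) / n) atTop (nhds 1) := by
    have : Tendsto (fun n : ℕ => 1 - (1:ℝ) / n) atTop (nhds (1 - 0)) :=
      tendsto_const_nhds.sub tendsto_one_div_atTop_nhds_zero_nat
    rw [sub_zero] at this
    refine this.congr' ?_
    filter_upwards [eventually_gt_atTop 0] with n hn
    have : (0:ℝ) < n := by exact_mod_cast hn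
    rw [Nat.cast_sub (by omega)]; field_simp; simp
  refine (h4.div h3 (by linarith)).congr' ?_
  filter_upwards [eventually_gt_atTop 0] with n hn
  have : (0:ℝ) < n := by exact_mod_cast hn
  simp only [Pi.div_apply]
  field_simp

lemma rho_mem (h2 : 2 ≤ mu1 p) : 0 ≤ rho p ∧ rho p ≤ 1 := by
  unfold rho
  constructor
  · apply div_nonneg <;> linarith
  · rw [div_le_one (by linarith)]; linarith

/-- weight of type `(k,a)` -/
noncomputable def wt (p : ℕ → ℝ) (x : ℕ × ℕ) : ℝ := p (x.1 + x.2 + 1) * binomP (rho p) (x.1 + x.2) x.2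

lemma wt_nonneg (hpnn : ∀ k, 0 ≤ p k) (h2 : 2 ≤ mu1 p) (x : ℕ × ℕ) : 0 ≤ wt p x := by
  obtain ⟨h, h'⟩ := rho_mem h2
  unfold wt binomP
  have : 0 ≤ 1 - rho p := by linarith
  have := hpnn (x.1 + x.2 + 1)
  positivity

lemma wt_diag (s : ℕ) : ∑ x ∈ Finset.HasAntidiagonal.antidiagonal s, wt p x = p (s+1) := by
  have h : ∀ x ∈ Finset.HasAntidiagonal.antidiagonal s, wt p x = p (s+1) * ((rho p)^x.2 * (1 - rho p)^x.1 * (s.choose x.2)) := by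
    intro x hx
    rw [Finset.HasAntidiagonal.mem_antidiagonal] at hx
    unfold wt binomP
    rw [hx]
    have : s - x.2 = x.1 := by omega
    rw [this]; ring
  rw [Finset.sum_congr rfl h, ← Finset.mul_sum]
  have h3 : ∑ x ∈ Finset.HasAntidiagonal.antidiagonal s, ((rho p)^x.2 * (1 - rho p)^x.1 * (s.choose x.2 : ℝ)) = 1 := by
    have := (Commute.all (1 - rho p) (rho p)).add_pow' s
    rw [sub_add_cancel, one_pow] at this
    refine Eq.trans ?_ this.symm
    refine Finset.sum_congr rfl fun x hx => ?_
    rw [Finset.HasAntidiagonal.mem_antidiagonal] at hx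
    rw [nsmul_eq_mul, ← Nat.choose_symm_of_eq_add hx.symm]
    ring
  rw [h3, mul_one]

lemma wt_summable (hpnn : ∀ k, 0 ≤ p k) (h2 : 2 ≤ mu1 p)
    (μ2 : ℝ) (hμ2 : HasSum (fun k : ℕ => (k : ℝ) ^ 2 * p k) μ2) :
    Summable (fun x : ℕ × ℕ => ((x.1 + x.2 + 1 : ℕ) : ℝ)^2 * wt p x) := by
  rw [← (Finset.HasAntidiagonal.sigmaAntidiagonalEquivProd (A := ℕ)).summable_iff]
  rw [summable_sigma_of_nonneg]
  · constructor
    · intro s; exact (hasSum_fintype _).summable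
    · have : ∀ s : ℕ, (∑' y : {x // x ∈ Finset.HasAntidiagonal.antidiagonal s},
          ((fun x : ℕ × ℕ => ((x.1 + x.2 + 1 : ℕ) : ℝ)^2 * wt p x) ∘ (Finset.HasAntidiagonal.sigmaAntidiagonalEquivProd (A := ℕ)))
            ⟨s, y⟩) = ((s+1 : ℕ):ℝ)^2 * p (s+1) := by
        intro s
        rw [tsum_fintype]
        rw [← wt_diag (p := p) s, Finset.mul_sum]
        rw [← Finset.sum_coe_sort (Finset.HasAntidiagonal.antidiagonal s) (fun x => ((s+1:ℕ):ℝ)^2 * wt p x)]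
        apply Finset.sum_congr rfl
        rintro ⟨y, hy⟩ _
        have hy' := hy
        rw [Finset.HasAntidiagonal.mem_antidiagonal] at hy'
        simp [Finset.HasAntidiagonal.sigmaAntidiagonalEquivProd, ← hy']
      simp_rw [this]
      exact (summable_nat_add_iff 1).2 hμ2.summable
  · intro x
    exact mul_nonneg (by positivity) (wt_nonneg hpnn h2 _)

end PartR


section PartS
variable {n : ℕ}

/-- non-root half-edges at `u` -/
noncomputable def Hset (d : Fin n → ℕ) (u : Fin n) : Finset (NH d) :=
  Finset.univ.filter (fun h => h.1.1 = u)

lemma card_Hset (d : Fin n → ℕ) (u : Fin n) : (Hset d u).card = d u - 1 := by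
  rw [← Fintype.card_fin (d u - 1), ← Finset.card_univ]
  symm
  refine Finset.card_bij (fun (j : Fin (d u - 1)) _ =>
    (⟨⟨u, ⟨j.1, by omega⟩⟩, by unfold IsNonRootHE; exact j.2⟩ : NH d)) ?_ ?_ ?_
  · intro j _; simp [Hset]
  · intro j _ j' _ h
    simpa [Fin.ext_iff] using h
  · rintro ⟨⟨v, j⟩, hj⟩ h
    simp only [Hset, Finset.mem_filter, Finset.mem_univ, true_and] at h
    subst h
    exact ⟨⟨j.1, hj⟩, Finset.mem_univ _, rfl⟩

lemma card_NH (d : Fin n → ℕ) : Fintype.card (NH d) = Nn d := by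
  unfold Nn
  rw [← Finset.card_univ, Finset.card_eq_sum_card_fiberwise (f := fun h : NH d => h.1.1) (t := Finset.univ)
    (fun _ _ => Finset.mem_univ _)]
  exact Finset.sum_congr rfl fun u _ => card_Hset d u

lemma Hset_disj (d : Fin n → ℕ) {u v : Fin n} (h : u ≠ v) : Disjoint (Hset d u) (Hset d v) := by
  rw [Finset.disjoint_left]
  intro x hx hy
  simp only [Hset, Finset.mem_filter, Finset.mem_univ, true_and] at hx hy
  exact h (hx.symm.trans hy)

noncomputable def ccs {d : Fin n → ℕ} (s : Fin (n-1) ↪ NH d) (u : Fin n) : ℕ :=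
  ((Finset.univ.map s) ∩ Hset d u).card

lemma cc_mkE (d : Fin n → ℕ) (hd : ∀ i, 1 ≤ d i) (s : Fin (n-1) ↪ NH d) (r) (u : Fin n) :
    cc (mkE d hd s r) u = ccs s u := by
  unfold cc ccs mkE
  rw [Nat.card_eq_fintype_card, Fintype.card_subtype]
  rw [← Finset.card_map s]
  congr 1
  ext h
  simp only [Finset.mem_map, Finset.mem_filter, Finset.mem_univ, true_and, Finset.mem_inter, Hset]
  constructor
  · rintro ⟨k, h1, h2⟩; subst h2; exact ⟨⟨k, rfl⟩, h1⟩
  · rintro ⟨⟨k, rfl⟩, h2⟩; exact ⟨k, h2, rfl⟩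

/-- indicator that `u` has type `(k,a)` -/
noncomputable def ind {d : Fin n → ℕ} (s : Fin (n-1) ↪ NH d) (x : ℕ × ℕ) (u : Fin n) : ℝ :=
  if ccs s u = x.2 ∧ d u = x.1 + x.2 + 1 then 1 else 0

noncomputable def nD (d : Fin n → ℕ) (k : ℕ) : ℕ := (Finset.univ.filter (fun u => d u = k)).card

lemma ind_sum (d : Fin n → ℕ) (x : ℕ × ℕ) (hx : x.2 ≤ n - 1) (u : Fin n) :
    ∑ s : Fin (n-1) ↪ NH d, ind s x u = if d u = x.1 + x.2 + 1 then
      ((n-1).factorial : ℝ) * ((x.1+x.2).choose x.2 * (Nn d - (x.1+x.2)).choose (n-1-x.2)) else 0 := by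
  split_ifs with h
  · have := emb_count (n-1) x.2 0 (Hset d u) ∅ (by simp) (by simpa using hx)
    simp only [Finset.inter_empty, Finset.card_empty, and_true, card_Hset, h, card_NH, Nat.choose_self,
      add_zero, mul_one, Nat.add_sub_cancel] at this
    push_cast at this
    rw [← this]
    refine Finset.sum_congr rfl fun s _ => ?_
    simp only [ind, ccs, h, and_true]
  · exact Finset.sum_eq_zero fun s _ => by simp [ind, h]

lemma ind_sum2 (d : Fin n → ℕ) (x : ℕ × ℕ) (hx : x.2 + x.2 ≤ n - 1) (u v : Fin n) (huv : u ≠ v) :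
    ∑ s : Fin (n-1) ↪ NH d, ind s x u * ind s x v = if d u = x.1 + x.2 + 1 ∧ d v = x.1 + x.2 + 1 then
      ((n-1).factorial : ℝ) * (((x.1+x.2).choose x.2 : ℝ)^2 *
        (Nn d - ((x.2+x.2)+(x.1+x.1))).choose (n-1-(x.2+x.2))) else 0 := by
  split_ifs with h
  · have := emb_count (n-1) x.2 x.2 (Hset d u) (Hset d v) (Hset_disj d huv) hx
    simp only [card_Hset, h.1, h.2, card_NH, Nat.add_sub_cancel] at this
    rw [show (x.2+x.2)+(x.1+x.1) = x.1 + x.2 + (x.1 + x.2) by ring]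
    push_cast at this
    rw [sq, ← this]
    refine Finset.sum_congr rfl fun s _ => ?_
    simp only [ind, ccs, h.1, h.2, and_true, ite_and, mul_ite, mul_one, mul_zero]
    split_ifs <;> simp
  · refine Finset.sum_eq_zero fun s _ => ?_
    by_cases h1 : d u = x.1 + x.2 + 1
    · have h2 : ¬ d v = x.1 + x.2 + 1 := fun h2 => h ⟨h1, h2⟩
      simp [ind, h2]
    · simp [ind, h1]

noncomputable def Cnt {d : Fin n → ℕ} (s : Fin (n-1) ↪ NH d) (x : ℕ × ℕ) : ℝ := ∑ u, ind s x u

lemma Cnt_sum (d : Fin n → ℕ) (x : ℕ × ℕ) (hx : x.2 ≤ n - 1) :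
    ∑ s : Fin (n-1) ↪ NH d, Cnt s x = nD d (x.1+x.2+1) * 
      (((n-1).factorial : ℝ) * ((x.1+x.2).choose x.2 * (Nn d - (x.1+x.2)).choose (n-1-x.2))) := by
  unfold Cnt
  rw [Finset.sum_comm]
  simp_rw [ind_sum d x hx]
  rw [← Finset.sum_filter]
  simp [nD]

lemma Cnt_sum2 (d : Fin n → ℕ) (x : ℕ × ℕ) (hx : x.2 + x.2 ≤ n - 1) :
    ∑ s : Fin (n-1) ↪ NH d, (Cnt s x)^2 = nD d (x.1+x.2+1) * 
      (((n-1).factorial : ℝ) * ((x.1+x.2).choose x.2 * (Nn d - (x.1+x.2)).choose (n-1-x.2)))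
      + ((nD d (x.1+x.2+1) : ℝ)^2 - nD d (x.1+x.2+1)) * (((n-1).factorial : ℝ) * (((x.1+x.2).choose x.2 : ℝ)^2 *
        (Nn d - ((x.2+x.2)+(x.1+x.1))).choose (n-1-(x.2+x.2)))) := by
  unfold Cnt
  simp_rw [sq, Finset.sum_mul_sum]
  rw [Finset.sum_comm]
  simp_rw [Finset.sum_comm (s := (Finset.univ : Finset (Fin (n-1) ↪ NH d)))]
  set c1 := (((n-1).factorial : ℝ) * ((x.1+x.2).choose x.2 * (Nn d - (x.1+x.2)).choose (n-1-x.2)))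
  set c2 := (((n-1).factorial : ℝ) * (((x.1+x.2).choose x.2 : ℝ)^2 *
        (Nn d - ((x.2+x.2)+(x.1+x.1))).choose (n-1-(x.2+x.2)))) with hc2
  have h : ∀ u v, ∑ s : Fin (n-1) ↪ NH d, ind s x u * ind s x v = 
     (if u = v then (if d u = x.1 + x.2 + 1 then (c1 - c2) else 0) else 0) + 
      (if d u = x.1 + x.2 + 1 then (1:ℝ) else 0) * (if d v = x.1 + x.2 + 1 then (1:ℝ) else 0) * c2 := by
    intro u v
    by_cases huv : u = v
    · subst huv
      have : ∀ s : Fin (n-1) ↪ NH d, ind s x u * ind s x u = ind s x u := by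
        intro s; unfold ind; split_ifs <;> simp
      simp_rw [this]
      rw [ind_sum d x (by omega)]
      split_ifs <;> simp [c1]
    · rw [ind_sum2 d x hx u v huv]
      by_cases h1 : d u = x.1 + x.2 + 1 <;> by_cases h2 : d v = x.1 + x.2 + 1 <;> simp [hc2, h1, h2, huv]
  simp_rw [h, Finset.sum_add_distrib, Finset.sum_ite_eq, Finset.mem_univ, if_true]
  simp_rw [← Finset.sum_mul, ← Finset.mul_sum]
  rw [← Finset.sum_filter, ← Finset.sum_filter]
  simp only [Finset.sum_const, nsmul_eq_mul, mul_one]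
  rw [← Finset.sum_mul]
  simp only [nD, hc2, Finset.sum_boole, sq]
  ring

lemma card_emb (d : Fin n → ℕ) : (Fintype.card (Fin (n-1) ↪ NH d) : ℝ) =
    ((n-1).factorial : ℝ) * (Nn d).choose (n-1) := by
  rw [Fintype.card_embedding_eq, card_NH, Fintype.card_fin, Nat.descFactorial_eq_factorial_mul_choose]
  push_cast; rfl

lemma Cnt_conc {dseq : (n : ℕ) → Fin n → ℕ} {p : ℕ → ℝ} 
    (hpconv : ∀ k : ℕ, Tendsto
      (fun n => (Nat.card {i : Fin n // dseq n i = k} : ℝ) / n) atTop (nhds (p k)))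
    (hge : ∀ n, n ≤ Nn (dseq n))
    (hrho : Tendsto (fun n => ((n - 1 : ℕ) : ℝ) / Nn (dseq n)) atTop (nhds (rho p))) (x : ℕ × ℕ) :
    Tendsto (fun n => (∑ s : Fin (n-1) ↪ NH (dseq n), (Cnt s x / n - wt p x)^2) /
      Fintype.card (Fin (n-1) ↪ NH (dseq n))) atTop (nhds 0) := by
  have hmN : ∀ n, n - 1 ≤ Nn (dseq n) := fun n => by have := hge n; omega
  have hm : Tendsto (fun n : ℕ => n - 1) atTop atTop := tendsto_sub_atTop_nat 1
  have hN : Tendsto (fun n => (Nn (dseq n) : ℝ)) atTop atTop :=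
    tendsto_natCast_atTop_atTop.comp (tendsto_atTop_mono hge tendsto_id)
  have q1 := choose_lim (fun n => n - 1) (fun n => Nn (dseq n)) (rho p) hmN hN hm hrho x.2 x.1
  have q2 := choose_lim (fun n => n - 1) (fun n => Nn (dseq n)) (rho p) hmN hN hm hrho (x.2+x.2) (x.1+x.1)
  have hx := hpconv (x.1+x.2+1)
  have h0 := tendsto_one_div_atTop_nhds_zero_nat (𝕜 := ℝ)
  set c : ℝ := ((x.1+x.2).choose x.2 : ℝ) with hc
  set w := wt p x with hw
  have hlim := (((hx.mul h0).mul (q1.const_mul c)).add (((hx.pow 2).sub (hx.mul h0)).mul (q2.const_mul (c^2)))).sub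
    ((hx.mul (q1.const_mul c)).const_mul (2*w)) |>.add_const (w^2)
  have hw2 : w = p (x.1+x.2+1) * (c * (rho p ^ x.2 * (1 - rho p)^x.1)) := by
    rw [hw]; unfold wt binomP
    rw [Nat.add_sub_cancel]; ring
  have e0 : p (x.1 + x.2 + 1) * 0 * (c * (rho p ^ x.2 * (1 - rho p) ^ x.1)) +
              (p (x.1 + x.2 + 1) ^ 2 - p (x.1 + x.2 + 1) * 0) *
                (c ^ 2 * (rho p ^ (x.2 + x.2) * (1 - rho p) ^ (x.1 + x.1))) -
            2 * w * (p (x.1 + x.2 + 1) * (c * (rho p ^ x.2 * (1 - rho p) ^ x.1))) + w ^ 2 = 0 := by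
    rw [hw2, pow_add, pow_add]; ring
  rw [e0] at hlim
  refine hlim.congr' ?_
  filter_upwards [eventually_gt_atTop (2 * x.2 + 1)] with n hn
  have hnpos : (0:ℝ) < n := by exact_mod_cast (by omega : 0 < n)
  have hcp : (0:ℝ) < (Nn (dseq n)).choose (n-1) := by exact_mod_cast Nat.choose_pos (hmN n)
  have hf : (0:ℝ) < (n-1).factorial := by exact_mod_cast Nat.factorial_pos _
  have hnD : (nD (dseq n) (x.1+x.2+1) : ℝ) = (Nat.card {i : Fin n // dseq n i = x.1+x.2+1} : ℝ) := by
    rw [nD, Nat.card_eq_fintype_card, Fintype.card_subtype]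
  have e1 : ∑ s : Fin (n-1) ↪ NH (dseq n), (Cnt s x / n - w)^2 =
      (∑ s : Fin (n-1) ↪ NH (dseq n), (Cnt s x)^2) / n^2 - 2 * w * (∑ s : Fin (n-1) ↪ NH (dseq n), Cnt s x) / n
       + Fintype.card (Fin (n-1) ↪ NH (dseq n)) * w^2 := by
    rw [Finset.sum_div, Finset.mul_sum, Finset.sum_div, ← Finset.sum_sub_distrib, ← nsmul_eq_mul, ← Finset.card_univ,
      ← Finset.sum_const, ← Finset.sum_add_distrib]
    refine Finset.sum_congr rfl fun s _ => ?_
    field_simp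
    ring
  rw [e1, Cnt_sum _ _ (by omega), Cnt_sum2 _ _ (by omega), card_emb, hnD, add_comm x.1 x.2]
  rw [add_comm x.1 x.2] at hc
  rw [← hc]
  field_simp

end PartS


section PartT
variable {n : ℕ}

noncomputable def avE (d : Fin n → ℕ) (X : Path d → ℝ) : ℝ := (∑ E ∈ execFin d, X E) / (execFin d).card

lemma avE_mono (d : Fin n → ℕ) {X Y : Path d → ℝ} (h : ∀ E ∈ execFin d, X E ≤ Y E) : avE d X ≤ avE d Y := by
  unfold avE
  gcongr with E hE
  exact h E hE

lemma avE_nonneg (d : Fin n → ℕ) {X : Path d → ℝ} (h : ∀ E, 0 ≤ X E) : 0 ≤ avE d X :=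
  div_nonneg (Finset.sum_nonneg fun E _ => h E) (by positivity)

lemma avE_add (d : Fin n → ℕ) (X Y : Path d → ℝ) : avE d (fun E => X E + Y E) = avE d X + avE d Y := by
  unfold avE; rw [Finset.sum_add_distrib, add_div]

lemma avE_sum (d : Fin n → ℕ) {ι : Type*} (S : Finset ι) (X : ι → Path d → ℝ) :
    avE d (fun E => ∑ i ∈ S, X i E) = ∑ i ∈ S, avE d (X i) := by
  unfold avE; rw [Finset.sum_comm, Finset.sum_div]

lemma avE_mul (d : Fin n → ℕ) (c : ℝ) (X : Path d → ℝ) : avE d (fun E => c * X E) = c * avE d X := by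
  unfold avE; rw [← Finset.mul_sum, mul_div_assoc]

lemma avE_const (d : Fin n → ℕ) (c : ℝ) (hc : 0 ≤ c) : avE d (fun _ => c) ≤ c := by
  unfold avE
  rw [Finset.sum_const, nsmul_eq_mul]
  rcases Nat.eq_zero_or_pos (execFin d).card with h | h
  · rw [h]; simpa using hc
  · have : (0:ℝ) < (execFin d).card := by exact_mod_cast h
    rw [mul_div_cancel_left₀ _ this.ne']

lemma avE_jensen (d : Fin n → ℕ) (X : Path d → ℝ) : avE d (fun E => |X E|) ≤ Real.sqrt (avE d (fun E => (X E)^2)) := by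
  apply Real.le_sqrt_of_sq_le
  unfold avE
  rcases Nat.eq_zero_or_pos (execFin d).card with h | h
  · rw [h]; simp
  · have h0 : (0:ℝ) < (execFin d).card := by exact_mod_cast h
    have := sq_sum_le_card_mul_sum_sq (s := execFin d) (f := fun E => |X E|)
    simp only [sq_abs] at this
    rw [div_pow, div_le_div_iff₀ (by positivity) h0]
    nlinarith

lemma card_rset (d : Fin n → ℕ) (hn : 1 ≤ n) (s : Fin (n-1) ↪ NH d) : ((rset d s).card : ℝ) = ((n-1).factorial : ℝ) := by
  have := cnt0 (n-1) (Finset.univ : Finset (Fin n)) (fun k => (s k).1.1) (by simp) (by simp; omega)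
  rw [← this]
  simp [rset]

lemma card_exec (d : Fin n → ℕ) (hd : ∀ i, 1 ≤ d i) (hn : 1 ≤ n) : ((execFin d).card : ℝ) =
    ((n-1).factorial : ℝ) * Fintype.card (Fin (n-1) ↪ NH d) := by
  have := exec_sum d hd (fun _ => (1:ℝ))
  simp only [Finset.sum_const, nsmul_eq_mul, mul_one] at this
  rw [this]
  simp_rw [card_rset d hn]
  simp [mul_comm]

lemma avE_s (d : Fin n → ℕ) (hd : ∀ i, 1 ≤ d i) (hn : 1 ≤ n) (X : Path d → ℝ) (Y : (Fin (n-1) ↪ NH d) → ℝ)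
    (h : ∀ s r, X (mkE d hd s r) = Y s) : avE d X = (∑ s, Y s) / Fintype.card (Fin (n-1) ↪ NH d) := by
  unfold avE
  rw [exec_sum d hd, card_exec d hd hn]
  simp_rw [h, Finset.sum_const, nsmul_eq_mul, card_rset d hn, ← Finset.mul_sum]
  have : ((n-1).factorial : ℝ) ≠ 0 := by exact_mod_cast Nat.factorial_ne_zero _
  rw [mul_div_mul_left _ _ this]

lemma avE_le (d : Fin n → ℕ) (hd : ∀ i, 1 ≤ d i) (hn : 1 ≤ n) (X : Path d → ℝ) (c : ℝ) (hc : 0 ≤ c)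
    (h : ∀ s, ∑ r ∈ rset d s, X (mkE d hd s r) ≤ ((n-1).factorial : ℝ) * c) : avE d X ≤ c := by
  unfold avE
  rw [exec_sum d hd, card_exec d hd hn]
  apply div_le_of_le_mul₀ (by positivity) hc
  refine (Finset.sum_le_sum fun s _ => h s).trans ?_
  rw [Finset.sum_const, nsmul_eq_mul, Finset.card_univ]
  apply le_of_eq; ring

noncomputable def indE {d : Fin n → ℕ} (E : Path d) (x : ℕ × ℕ) (u : Fin n) : ℝ :=
  if cc E u = x.2 ∧ d u = x.1 + x.2 + 1 then 1 else 0

lemma indE_nonneg {d : Fin n → ℕ} (E : Path d) (x : ℕ × ℕ) (u : Fin n) : 0 ≤ indE E x u := by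
  unfold indE; split_ifs <;> simp
lemma indE_le {d : Fin n → ℕ} (E : Path d) (x : ℕ × ℕ) (u : Fin n) : indE E x u ≤ 1 := by
  unfold indE; split_ifs <;> simp

noncomputable def CntE {d : Fin n → ℕ} (E : Path d) (x : ℕ × ℕ) : ℝ := ∑ u, indE E x u

lemma indE_mkE (d : Fin n → ℕ) (hd : ∀ i, 1 ≤ d i) (s : Fin (n-1) ↪ NH d) (r) (x : ℕ × ℕ) (u : Fin n) :
    indE (mkE d hd s r) x u = ind s x u := by
  unfold indE ind; rw [cc_mkE]

lemma CntE_mkE (d : Fin n → ℕ) (hd : ∀ i, 1 ≤ d i) (s : Fin (n-1) ↪ NH d) (r) (x : ℕ × ℕ) :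
    CntE (mkE d hd s r) x = Cnt s x := by
  unfold CntE Cnt; simp_rw [indE_mkE]

lemma CntE_nonneg {d : Fin n → ℕ} (E : Path d) (x : ℕ × ℕ) : 0 ≤ CntE E x :=
  Finset.sum_nonneg fun u _ => indE_nonneg E x u

lemma CntE_le {d : Fin n → ℕ} (E : Path d) (x : ℕ × ℕ) : CntE E x ≤ n := by
  refine (Finset.sum_le_sum fun u _ => indE_le E x u).trans ?_
  simp

lemma cc_fiber {d : Fin n → ℕ} (E : Path d) (g : Fin n → ℝ) : ∑ j, g (E j).2.1 = ∑ u, (cc E u : ℝ) * g u := by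
  have : ∀ u, (cc E u : ℝ) = ∑ j, if (E j).2.1 = u then (1:ℝ) else 0 := by
    intro u
    unfold cc
    rw [Nat.card_eq_fintype_card, Fintype.card_subtype]; simp
  simp_rw [this, Finset.sum_mul]
  rw [Finset.sum_comm]
  simp

lemma G_eq {d : Fin n → ℕ} (E : Path d) (y : ℕ × ℕ) : ∑ j, indE E y (E j).2.1 = y.2 * CntE E y := by
  rw [cc_fiber, CntE, Finset.mul_sum]
  refine Finset.sum_congr rfl fun u _ => ?_
  unfold indE
  split_ifs with h
  · rw [h.1]
  · simp

noncomputable def A4 {d : Fin n → ℕ} (E : Path d) (x y : ℕ × ℕ) : ℝ :=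
  ∑ j, indE E x (E j).1.1 * indE E y (E j).2.1

lemma A4_var (d : Fin n → ℕ) (hd : ∀ i, 1 ≤ d i) (hn : 3 ≤ n) (x y : ℕ × ℕ) :
    avE d (fun E => (A4 E x y - CntE E x * (y.2 * CntE E y) / ((n:ℝ)-1))^2) ≤ 3 * (n:ℝ) + (n:ℝ)^2/((n:ℝ)-2) := by
  obtain ⟨t, rfl⟩ : ∃ t, n = t + 3 := ⟨n - 3, by omega⟩
  apply avE_le d hd (by omega)
  · push_cast
    have : (t:ℝ) + 3 - 2 = t + 1 := by ring
    rw [this]; positivity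
  intro s
  have h := var_bound t (by simp : Fintype.card (Fin (t+3)) = t + 3) (fun k => (s k).1.1)
    (ind s x) (fun u => by unfold ind; split_ifs <;> simp) (fun u => by unfold ind; split_ifs <;> simp)
    (fun j => ind s y (s j).1.1) (fun u => by unfold ind; split_ifs <;> simp) (fun u => by unfold ind; split_ifs <;> simp)
  have e : (((t+3 : ℕ) : ℝ) - 2) = t + 1 := by push_cast; ring
  have e2 : (((t+3 : ℕ) : ℝ) - 1) = t + 2 := by push_cast; ring
  rw [e, e2]
  push_cast
  refine le_trans (le_of_eq ?_) h
  refine Finset.sum_congr rfl fun r _ => ?_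
  have e3 := G_eq (mkE d hd s r) y
  simp_rw [indE_mkE] at e3
  rw [← e3, CntE_mkE]
  unfold A4
  simp_rw [indE_mkE]
  rfl

end PartT


section PartT2
variable {n : ℕ}

lemma A4_bd {d : Fin n → ℕ} (hn : 3 ≤ n) (E : Path d) (x y : ℕ × ℕ) (wx wy : ℝ) :
    |A4 E x y / n - wx * (y.2 * wy)| ≤ |(1/n) * (A4 E x y - CntE E x * (y.2 * CntE E y) / ((n:ℝ)-1))| + 1/n
      + y.2 * (|CntE E x / n - wx| + |wx| * |CntE E y / n - wy|) := by
  have hn0 : (3:ℝ) ≤ n := by exact_mod_cast hn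
  have hG : (y.2:ℝ) * CntE E y ≤ n - 1 := by
    rw [← G_eq]
    refine (Finset.sum_le_sum fun j _ => indE_le E y _).trans ?_
    simp [Nat.cast_sub (by omega : 1 ≤ n)]
  have hG0 : 0 ≤ (y.2:ℝ) * CntE E y := mul_nonneg (by positivity) (CntE_nonneg E y)
  have hF := CntE_le E x
  have hF0 := CntE_nonneg E x
  have hC := CntE_le E y
  have hC0 := CntE_nonneg E y
  set F := CntE E x
  set C := CntE E y
  have e : A4 E x y / n - wx * (y.2 * wy) = (1/n) * (A4 E x y - F * (y.2 * C) / ((n:ℝ)-1))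
     + F * (y.2 * C) / ((n:ℝ)^2 * (n-1)) + y.2 * ((F/n - wx) * (C/n) + wx * (C/n - wy)) := by
    have : (n:ℝ) - 1 ≠ 0 := by linarith
    field_simp
    ring
  rw [e]
  refine (abs_add_three _ _ _).trans ?_
  gcongr
  · rw [abs_of_nonneg (div_nonneg (mul_nonneg hF0 hG0) (mul_nonneg (by positivity) (by linarith)))]
    rw [div_le_div_iff₀ (mul_pos (by positivity) (by linarith)) (by linarith)]
    have := mul_le_mul hF hG hG0 (by positivity)
    nlinarith
  · rw [abs_mul, abs_of_nonneg (by positivity : (0:ℝ) ≤ y.2)]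
    gcongr
    refine (abs_add_le _ _).trans ?_
    rw [abs_mul, abs_mul]
    gcongr
    have h1 : |C/n| ≤ 1 := by
      rw [abs_of_nonneg (by positivity), div_le_one (by linarith)]; exact hC
    nlinarith [abs_nonneg (F/n - wx)]

lemma A4_lim {dseq : (n : ℕ) → Fin n → ℕ} {p : ℕ → ℝ} (hd : ∀ n i, 1 ≤ dseq n i)
    (hpconv : ∀ k : ℕ, Tendsto
      (fun n => (Nat.card {i : Fin n // dseq n i = k} : ℝ) / n) atTop (nhds (p k)))
    (hge : ∀ n, n ≤ Nn (dseq n))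
    (hrho : Tendsto (fun n => ((n - 1 : ℕ) : ℝ) / Nn (dseq n)) atTop (nhds (rho p))) (x y : ℕ × ℕ) :
    Tendsto (fun n => avE (dseq n) (fun E => |A4 E x y / n - wt p x * (y.2 * wt p y)|)) atTop (nhds 0) := by
  have hx := Cnt_conc hpconv hge hrho x
  have hy := Cnt_conc hpconv hge hrho y
  have h0 := tendsto_one_div_atTop_nhds_zero_nat (𝕜 := ℝ)
  have h2 : Tendsto (fun n : ℕ => 1/((n:ℝ) - 2)) atTop (nhds 0) := by
    have : Tendsto (fun n : ℕ => (n:ℝ) - 2) atTop atTop :=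
      tendsto_atTop_add_const_right _ _ tendsto_natCast_atTop_atTop
    simp_rw [one_div]
    exact tendsto_inv_atTop_zero.comp this
  have hlim := ((((h0.const_mul 3).add h2).sqrt).add h0).add
    ((hx.sqrt.add ((hy.sqrt).const_mul |wt p x|)).const_mul (y.2:ℝ))
  simp only [mul_zero, add_zero, Real.sqrt_zero] at hlim
  refine squeeze_zero' (Eventually.of_forall fun n => avE_nonneg _ fun E => abs_nonneg _) ?_ hlim
  filter_upwards [eventually_ge_atTop 3] with n hn
  have hn0 : (3:ℝ) ≤ n := by exact_mod_cast hn
  refine (avE_mono _ fun E _ => A4_bd hn E x y (wt p x) (wt p y)).trans ?_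
  rw [avE_add, avE_add, avE_mul, avE_add, avE_mul]
  have c1 : ∀ z : ℕ × ℕ, avE (dseq n) (fun E => |CntE E z / n - wt p z|) ≤ 
     √((∑ s : Fin (n-1) ↪ NH (dseq n), (Cnt s z / n - wt p z)^2) /
      Fintype.card (Fin (n-1) ↪ NH (dseq n))) := by
    intro z
    refine (avE_jensen _ _).trans (le_of_eq ?_)
    rw [avE_s (dseq n) (hd n) (by omega) _ (fun s => (Cnt s z / n - wt p z)^2)]
    intro s r; rw [CntE_mkE]
  gcongr
  · refine (avE_jensen _ _).trans ?_
    apply Real.sqrt_le_sqrt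
    simp_rw [mul_pow]
    rw [avE_mul]
    have := A4_var (dseq n) (hd n) hn x y
    refine (mul_le_mul_of_nonneg_left this (by positivity)).trans (le_of_eq ?_)
    have : (n:ℝ) - 2 ≠ 0 := by linarith
    field_simp
  · exact avE_const _ _ (by positivity)
  · exact c1 x
  · exact c1 y

lemma cc_le (d : Fin n → ℕ) (hd : ∀ i, 1 ≤ d i) (s : Fin (n-1) ↪ NH d) (r) (u : Fin n) :
    cc (mkE d hd s r) u ≤ d u - 1 := by
  rw [cc_mkE, ← card_Hset]
  exact Finset.card_le_card Finset.inter_subset_right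

lemma tail_av (d : Fin n → ℕ) (hd : ∀ i, 1 ≤ d i) (hn : 2 ≤ n) (f g : Fin n → ℝ) (hf : ∀ u, 0 ≤ f u)
    (hg : ∀ u, 0 ≤ g u) : avE d (fun E => ∑ j, f (E j).1.1 * g (E j).2.1) ≤
      (∑ u, f u) * (∑ u, d u * g u) / ((n:ℝ) - 1) := by
  obtain ⟨t, rfl⟩ : ∃ t, n = t + 2 := ⟨n - 2, by omega⟩
  have hF : 0 ≤ ∑ u, f u := Finset.sum_nonneg fun u _ => hf u
  have hG : 0 ≤ ∑ u, (d u : ℝ) * g u := Finset.sum_nonneg fun u _ => mul_nonneg (by positivity) (hg u)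
  have e : (((t+2 : ℕ) : ℝ) - 1) = t + 1 := by push_cast; ring
  rw [e]
  apply avE_le d hd (by omega)
  · positivity
  intro s
  have h := mom1 t (by simp : Fintype.card (Fin (t+2)) = t + 2) (fun k => (s k).1.1) f (fun j => g (s j).1.1)
  refine (le_of_eq h).trans ?_
  have h3 : ∑ j, g (s j).1.1 ≤ ∑ u, (d u : ℝ) * g u := by
    have := cc_fiber (mkE d hd s (fun _ => 0)) g
    refine (le_of_eq this).trans ?_
    gcongr with u _
    · exact hg u
    · have := cc_le d hd s (fun _ => 0) u
      omega
  calc _ ≤ (t.factorial : ℝ) * ∑ j, g (s j).1.1 * (∑ u, f u) := by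
        gcongr with j _
        · exact hg _
        · have := hf (s j).1.1; linarith
    _ ≤ (t.factorial : ℝ) * ((∑ u, (d u : ℝ) * g u) * (∑ u, f u)) := by
        rw [← Finset.sum_mul]
        gcongr
    _ = _ := by
        have : t + 2 - 1 = t + 1 := by omega
        rw [this, Nat.factorial_succ]
        push_cast
        field_simp

end PartT2


section PartU
variable {n : ℕ}

lemma exec_rep (d : Fin n → ℕ) (hd : ∀ i, 1 ≤ d i) (E : Path d) (hE : E ∈ execFin d) :
    ∃ s r, r ∈ rset d s ∧ E = mkE d hd s r := by
  simp only [execFin, Finset.mem_filter, Finset.mem_univ, true_and] at hE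
  rw [exec_iff d hd] at hE
  obtain ⟨h1, h2, h3, h4⟩ := hE
  refine ⟨⟨fun k => ⟨(E k).2, h2 k⟩, fun a b h => h3 (by simpa using h)⟩, fun k => (E k).1.1, ?_, ?_⟩
  · simp only [rset, Finset.mem_filter, Finset.mem_univ, true_and]
    exact h4
  · funext k
    unfold mkE
    rw [rootHE_eq d hd _ (h1 k)]
    rfl

lemma exec_cc_le (d : Fin n → ℕ) (hd : ∀ i, 1 ≤ d i) (E : Path d) (hE : E ∈ execFin d) (u) : cc E u ≤ d u - 1 := by
  obtain ⟨s, r, _, rfl⟩ := exec_rep d hd E hE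
  exact cc_le d hd s r u

/-- `d u - 1 - cc u` -/
noncomputable def kk {d : Fin n → ℕ} (E : Path d) (u : Fin n) : ℕ := d u - 1 - cc E u

noncomputable def TK (K : ℕ) : Finset (ℕ × ℕ) :=
  (Finset.range K ×ˢ Finset.range K).filter (fun x => x.1 + x.2 + 1 ≤ K)

lemma mem_TK (K : ℕ) (x : ℕ × ℕ) : x ∈ TK K ↔ x.1 + x.2 + 1 ≤ K := by
  simp only [TK, Finset.mem_filter, Finset.mem_product, Finset.mem_range]
  omega

lemma ind_TK {d : Fin n → ℕ} (hd : ∀ i, 1 ≤ d i) (E : Path d) (u : Fin n) (hc : cc E u ≤ d u - 1) (K : ℕ) (h : ℕ → ℝ) :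
    ∑ x ∈ TK K, h x.1 * indE E x u = if d u ≤ K then h (kk E u) else 0 := by
  have hdu := hd u
  have e : ∀ x, h x.1 * indE E x u = if x = (kk E u, cc E u) then h (kk E u) else 0 := by
    intro x
    unfold indE
    by_cases hx : x = (kk E u, cc E u)
    · rw [if_pos hx, hx, if_pos, mul_one]
      simp only [true_and, kk]; omega
    · rw [if_neg hx, if_neg, mul_zero]
      rintro ⟨h1, h2⟩
      apply hx
      ext <;> simp only [kk] <;> omega
  simp_rw [e]
  rw [Finset.sum_ite_eq']
  congr 1
  rw [mem_TK]
  simp only [kk, eq_iff_iff]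
  omega

noncomputable def Zf {d : Fin n → ℕ} (φ : ℕ → ℕ → ℝ) (E : Path d) : ℝ := ∑ j, φ (kk E (E j).1.1) (kk E (E j).2.1)

noncomputable def ZK {d : Fin n → ℕ} (φ : ℕ → ℕ → ℝ) (K : ℕ) (E : Path d) : ℝ :=
  ∑ x ∈ TK K, ∑ y ∈ TK K, φ x.1 y.1 * A4 E x y

lemma ZK_eq {d : Fin n → ℕ} (hd : ∀ i, 1 ≤ d i) (E : Path d) (hE : E ∈ execFin d) (φ : ℕ → ℕ → ℝ) (K : ℕ) :
    ZK φ K E = ∑ j, if d (E j).1.1 ≤ K then (if d (E j).2.1 ≤ K then φ (kk E (E j).1.1) (kk E (E j).2.1) else 0) else 0 := by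
  unfold ZK A4
  simp_rw [Finset.mul_sum]
  simp_rw [Finset.sum_comm (t := (Finset.univ : Finset (Fin (n-1))))]
  refine Finset.sum_congr rfl fun j _ => ?_
  have h1 : ∀ x : ℕ × ℕ, ∑ y ∈ TK K, φ x.1 y.1 * (indE E x (E j).1.1 * indE E y (E j).2.1) =
      (if d (E j).2.1 ≤ K then φ x.1 (kk E (E j).2.1) else 0) * indE E x (E j).1.1 := by
    intro x
    rw [← ind_TK hd E _ (exec_cc_le d hd E hE _) K (φ x.1), Finset.sum_mul]
    exact Finset.sum_congr rfl fun y _ => by ring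
  simp_rw [h1]
  rw [ind_TK hd E _ (exec_cc_le d hd E hE _) K (fun k => if d (E j).2.1 ≤ K then φ k (kk E (E j).2.1) else 0)]

lemma Z_tail {d : Fin n → ℕ} (hd : ∀ i, 1 ≤ d i) (E : Path d) (hE : E ∈ execFin d) (φ : ℕ → ℕ → ℝ)
    (hφ0 : ∀ k l, 0 ≤ φ k l) (hφ : ∀ k l, φ k l ≤ ((k:ℝ)+1)*(l+1)) (K : ℕ) :
    |Zf φ E - ZK φ K E| ≤ (∑ j, (if K < d (E j).1.1 then (d (E j).1.1 : ℝ) else 0) * (d (E j).2.1 : ℝ))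
      + ∑ j, (d (E j).1.1 : ℝ) * (if K < d (E j).2.1 then (d (E j).2.1 : ℝ) else 0) := by
  rw [ZK_eq hd E hE, Zf, ← Finset.sum_sub_distrib, ← Finset.sum_add_distrib]
  refine (Finset.abs_sum_le_sum_abs _ _).trans (Finset.sum_le_sum fun j _ => ?_)
  have hb : φ (kk E (E j).1.1) (kk E (E j).2.1) ≤ (d (E j).1.1 : ℝ) * (d (E j).2.1 : ℝ) := by
    refine (hφ _ _).trans ?_
    have h1 : kk E (E j).1.1 + 1 ≤ d (E j).1.1 := by unfold kk; have := hd (E j).1.1; omega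
    have h2 : kk E (E j).2.1 + 1 ≤ d (E j).2.1 := by unfold kk; have := hd (E j).2.1; omega
    have h1' : (kk E (E j).1.1 : ℝ) + 1 ≤ d (E j).1.1 := by exact_mod_cast h1
    have h2' : (kk E (E j).2.1 : ℝ) + 1 ≤ d (E j).2.1 := by exact_mod_cast h2
    gcongr
  have h0 := hφ0 (kk E (E j).1.1) (kk E (E j).2.1)
  have hp : 0 ≤ (d (E j).1.1 : ℝ) * (d (E j).2.1 : ℝ) := by positivity
  split_ifs <;> first | omega | skip
  all_goals simp only [sub_self, sub_zero, zero_mul, mul_zero, abs_zero, add_zero, zero_add, abs_of_nonneg h0, le_refl]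
  all_goals linarith

lemma Z_tail_av {d : Fin n → ℕ} (hd : ∀ i, 1 ≤ d i) (hn : 2 ≤ n) (φ : ℕ → ℕ → ℝ)
    (hφ0 : ∀ k l, 0 ≤ φ k l) (hφ : ∀ k l, φ k l ≤ ((k:ℝ)+1)*(l+1)) (K : ℕ) :
    avE d (fun E => |Zf φ E - ZK φ K E|) ≤ 2 * (∑ i, (d i : ℝ)^2) * (∑ i, if K < d i then (d i : ℝ)^2 else 0) / ((n:ℝ) - 1) := by
  have hn0 : (2:ℝ) ≤ n := by exact_mod_cast hn
  refine (avE_mono d fun E hE => Z_tail hd E hE φ hφ0 hφ K).trans ?_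
  rw [avE_add]
  have h1 := tail_av d hd hn (fun u => if K < d u then (d u : ℝ) else 0) (fun u => (d u : ℝ))
    (fun u => by split_ifs <;> positivity) (fun u => by positivity)
  have h2 := tail_av d hd hn (fun u => (d u : ℝ)) (fun u => if K < d u then (d u : ℝ) else 0)
    (fun u => by positivity) (fun u => by split_ifs <;> positivity)
  refine (add_le_add h1 h2).trans ?_
  rw [← add_div]
  have hsq : ∀ u, (d u : ℝ) ≤ (d u : ℝ)^2 := fun u => by exact_mod_cast Nat.le_self_pow (by norm_num) _
  have e1 : ∑ u, (if K < d u then (d u : ℝ) else 0) ≤ ∑ i, if K < d i then (d i : ℝ)^2 else 0 := by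
    gcongr with u _
    split_ifs
    · exact hsq u
    · exact le_refl _
  have e2 : ∑ u, (d u : ℝ) ≤ ∑ u, (d u : ℝ)^2 := by
    gcongr with u _
    exact hsq u
  have e3 : ∑ u, (d u : ℝ) * (if K < d u then (d u : ℝ) else 0) = ∑ i, if K < d i then (d i : ℝ)^2 else 0 := by
    refine Finset.sum_congr rfl fun u _ => ?_
    split_ifs <;> ring
  have e4 : ∑ u, (d u : ℝ) * d u = ∑ u, (d u : ℝ)^2 := by simp_rw [sq]
  rw [e3, e4]
  have p1 : 0 ≤ ∑ u, (d u : ℝ)^2 := by positivity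
  have p2 : 0 ≤ ∑ i, if K < d i then (d i : ℝ)^2 else 0 := Finset.sum_nonneg fun u _ => by split_ifs <;> positivity
  apply div_le_div_of_nonneg_right _ (by linarith)
  nlinarith

noncomputable def LLf (p : ℕ → ℝ) (φ : ℕ → ℕ → ℝ) (z : (ℕ × ℕ) × (ℕ × ℕ)) : ℝ :=
  φ z.1.1 z.2.1 * (wt p z.1 * (z.2.2 * wt p z.2))

lemma LLf_summable {p : ℕ → ℝ} (hw : ∀ x, 0 ≤ wt p x)
    (hs : Summable (fun x : ℕ × ℕ => ((x.1 + x.2 + 1 : ℕ) : ℝ)^2 * wt p x)) (φ : ℕ → ℕ → ℝ)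
    (hφ0 : ∀ k l, 0 ≤ φ k l) (hφ : ∀ k l, φ k l ≤ ((k:ℝ)+1)*(l+1)) : Summable (LLf p φ) := by
  have h := hs.mul_of_nonneg hs (fun x => mul_nonneg (by positivity) (hw x)) (fun x => mul_nonneg (by positivity) (hw x))
  refine Summable.of_nonneg_of_le (fun z => ?_) (fun z => ?_) h
  · exact mul_nonneg (hφ0 _ _) (mul_nonneg (hw _) (mul_nonneg (by positivity) (hw _)))
  · obtain ⟨⟨k, a⟩, ⟨l, b⟩⟩ := z
    simp only [LLf]
    have h1 := hw (k,a)
    have h2 := hw (l,b)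
    have e1 : (k:ℝ) + 1 ≤ ((k+a+1 : ℕ):ℝ)^2 := by
      exact_mod_cast ((by omega : k + 1 ≤ k+a+1).trans (Nat.le_self_pow (by norm_num) _))
    have e2 : ((l:ℝ) + 1) * b ≤ ((l+b+1 : ℕ):ℝ)^2 := by
      exact_mod_cast ((Nat.mul_le_mul (by omega) (by omega)).trans (le_of_eq (sq _).symm) : (l + 1) * b ≤ (l+b+1)^2)
    calc _ ≤ (((k:ℝ)+1)*(l+1)) * (wt p (k,a) * (b * wt p (l,b))) := by
          gcongr; exact hφ k l
      _ = (((k:ℝ)+1) * wt p (k,a)) * ((((l:ℝ)+1) * b) * wt p (l,b)) := by ring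
      _ ≤ _ := by gcongr

lemma LK_lim {p : ℕ → ℝ} {φ : ℕ → ℕ → ℝ} (h : Summable (LLf p φ)) :
    Tendsto (fun K => ∑ x ∈ TK K, ∑ y ∈ TK K, LLf p φ (x, y)) atTop (nhds (∑' z, LLf p φ z)) := by
  have h2 : Tendsto (fun K => TK K ×ˢ TK K) atTop atTop := by
    apply tendsto_atTop_finset_of_monotone
    · intro K K' hK z
      simp only [Finset.mem_product, mem_TK]
      omega
    · intro z
      refine ⟨z.1.1 + z.1.2 + z.2.1 + z.2.2 + 1, ?_⟩
      simp only [Finset.mem_product, mem_TK]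
      omega
  refine (h.hasSum.comp h2).congr fun K => ?_
  simp only [Function.comp]
  rw [Finset.sum_product]

lemma ZK_lim {dseq : (n : ℕ) → Fin n → ℕ} {p : ℕ → ℝ} (hd : ∀ n i, 1 ≤ dseq n i)
    (hpconv : ∀ k : ℕ, Tendsto
      (fun n => (Nat.card {i : Fin n // dseq n i = k} : ℝ) / n) atTop (nhds (p k)))
    (hge : ∀ n, n ≤ Nn (dseq n))
    (hrho : Tendsto (fun n => ((n - 1 : ℕ) : ℝ) / Nn (dseq n)) atTop (nhds (rho p))) (φ : ℕ → ℕ → ℝ) (K : ℕ)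
    (hφ0 : ∀ k l, 0 ≤ φ k l) :
    Tendsto (fun n => avE (dseq n) (fun E => |ZK φ K E / n - ∑ x ∈ TK K, ∑ y ∈ TK K, LLf p φ (x, y)|)) atTop (nhds 0) := by
  have hlim : Tendsto (fun n => ∑ x ∈ TK K, ∑ y ∈ TK K, φ x.1 y.1 *
      avE (dseq n) (fun E => |A4 E x y / n - wt p x * (y.2 * wt p y)|)) atTop (nhds 0) := by
    have : Tendsto (fun n => ∑ x ∈ TK K, ∑ y ∈ TK K, φ x.1 y.1 *
      avE (dseq n) (fun E => |A4 E x y / n - wt p x * (y.2 * wt p y)|)) atTop (nhds (∑ x ∈ TK K, ∑ y ∈ TK K, φ x.1 y.1 * 0)) :=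
      tendsto_finset_sum _ fun x _ => tendsto_finset_sum _ fun y _ => (A4_lim hd hpconv hge hrho x y).const_mul _
    simpa using this
  refine squeeze_zero (fun n => avE_nonneg _ fun E => abs_nonneg _) (fun n => ?_) hlim
  simp_rw [← avE_mul, ← avE_sum]
  apply avE_mono
  intro E _
  unfold ZK
  rw [Finset.sum_div, ← Finset.sum_sub_distrib]
  refine (Finset.abs_sum_le_sum_abs _ _).trans (Finset.sum_le_sum fun x _ => ?_)
  rw [Finset.sum_div, ← Finset.sum_sub_distrib]
  refine (Finset.abs_sum_le_sum_abs _ _).trans (Finset.sum_le_sum fun y _ => ?_)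
  rw [LLf, mul_div_assoc, ← mul_sub, abs_mul, abs_of_nonneg (hφ0 _ _)]

lemma Zf_lim {dseq : (n : ℕ) → Fin n → ℕ} {p : ℕ → ℝ} (hd : ∀ n i, 1 ≤ dseq n i)
    (hpconv : ∀ k : ℕ, Tendsto
      (fun n => (Nat.card {i : Fin n // dseq n i = k} : ℝ) / n) atTop (nhds (p k)))
    (hge : ∀ n, n ≤ Nn (dseq n))
    (hrho : Tendsto (fun n => ((n - 1 : ℕ) : ℝ) / Nn (dseq n)) atTop (nhds (rho p))) 
    (hw : ∀ x, 0 ≤ wt p x)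
    (hs : Summable (fun x : ℕ × ℕ => ((x.1 + x.2 + 1 : ℕ) : ℝ)^2 * wt p x))
    (μ2 : ℝ) (hμ2 : HasSum (fun k : ℕ => (k : ℝ) ^ 2 * p k) μ2) (hμ0 : 0 < μ2)
    (hμ2conv : Tendsto (fun n => (∑ i, (dseq n i : ℝ) ^ 2) / n) atTop (nhds μ2))
    (φ : ℕ → ℕ → ℝ)
    (hφ0 : ∀ k l, 0 ≤ φ k l) (hφ : ∀ k l, φ k l ≤ ((k:ℝ)+1)*(l+1)) :
    Tendsto (fun n => avE (dseq n) (fun E => |Zf φ E / n - ∑' z, LLf p φ z|)) atTop (nhds 0) := by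
  rw [Metric.tendsto_nhds]
  intro ε hε
  have hL := LK_lim (LLf_summable hw hs φ hφ0 hφ)
  rw [Metric.tendsto_nhds] at hL
  set δ := ε / (12 * (μ2 + 1)) with hδ
  have hδ0 : 0 < δ := by positivity
  obtain ⟨K, hK1, hK2⟩ := ((hL (ε/3) (by positivity)).and (tail_small hpconv μ2 hμ2 hμ2conv δ hδ0)).exists
  have hZ := ZK_lim hd hpconv hge hrho φ K hφ0
  rw [Metric.tendsto_nhds] at hZ
  filter_upwards [hK2, hZ (ε/3) (by positivity), eventually_ge_atTop 2,
    hμ2conv.eventually (gt_mem_nhds (by linarith : μ2 < μ2 + 1))] with n h1 h2 hn h3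
  have hn0 : (2:ℝ) ≤ n := by exact_mod_cast hn
  rw [Real.dist_eq] at *
  rw [sub_zero, abs_of_nonneg (avE_nonneg _ fun E => abs_nonneg _)] at *
  set LK := ∑ x ∈ TK K, ∑ y ∈ TK K, LLf p φ (x, y)
  set L := ∑' z, LLf p φ z
  have hpt : ∀ E : Path (dseq n), |Zf φ E / n - L| ≤ (1/n) * |Zf φ E - ZK φ K E| + |ZK φ K E / n - LK| + |LK - L| := by
    intro E
    have e : Zf φ E / n - L = (1/n) * (Zf φ E - ZK φ K E) + (ZK φ K E / n - LK) + (LK - L) := by ring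
    rw [e]
    refine (abs_add_three _ _ _).trans ?_
    rw [abs_mul, abs_of_nonneg (by positivity : (0:ℝ) ≤ 1/n)]
  have h4 := Z_tail_av (hd n) hn φ hφ0 hφ K
  have h5 : (1/n) * avE (dseq n) (fun E => |Zf φ E - ZK φ K E|) ≤ ε / 3 := by
    set S := ∑ i, (dseq n i : ℝ)^2
    set τ := ∑ i, if K < dseq n i then (dseq n i : ℝ)^2 else 0
    have hτ0 : 0 ≤ τ := Finset.sum_nonneg fun i _ => by split_ifs <;> positivity
    have hS0 : 0 ≤ S := by positivity
    have hS : S ≤ (μ2 + 1) * n := by rw [div_lt_iff₀ (by linarith)] at h3; exact h3.le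
    have hτ : τ ≤ δ * n := by rw [div_le_iff₀ (by linarith)] at h1; exact h1
    calc _ ≤ (1/n) * (2 * S * τ / ((n:ℝ)-1)) := by gcongr
      _ ≤ (1/n) * (2 * ((μ2+1)*n) * (δ * n) / ((n:ℝ)/2)) := by
          gcongr
          linarith
      _ = 4 * (μ2 + 1) * δ := by field_simp; ring
      _ = ε / 3 := by rw [hδ]; field_simp; norm_num
  calc _ ≤ _ := avE_mono _ fun E _ => hpt E
    _ < ε := by
      rw [avE_add, avE_add, avE_mul]
      have := avE_const (dseq n) |LK - L| (abs_nonneg _)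
      linarith

end PartU


section PartV
variable {n : ℕ}

lemma exec_inj (d : Fin n → ℕ) (hd : ∀ i, 1 ≤ d i) (E : Path d) (hE : E ∈ execFin d) :
    Function.Injective (fun j => (E j).1.1) := by
  obtain ⟨s, r, hr, rfl⟩ := exec_rep d hd E hE
  simp only [rset, Finset.mem_filter, Finset.mem_univ, true_and] at hr
  exact val_inj _ _ _ r hr

lemma root_unique (d : Fin n → ℕ) (hd : ∀ i, 1 ≤ d i) (E : Path d) (hE : E ∈ execFin d) (u v : Fin n)
    (hu : ¬ IsNonRootV E u) (hv : ¬ IsNonRootV E v) : u = v := by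
  by_contra huv
  have h1 : (Finset.univ.image (fun j => (E j).1.1)).card = n - 1 := by
    rw [Finset.card_image_of_injective _ (exec_inj d hd E hE)]; simp
  have h2 : (Finset.univ.image (fun j => (E j).1.1)) ⊆ (Finset.univ.erase u).erase v := by
    intro x hx
    simp only [Finset.mem_image, Finset.mem_univ, true_and] at hx
    simp only [Finset.mem_erase, Finset.mem_univ, and_true]
    exact ⟨fun h => hv (h ▸ hx), fun h => hu (h ▸ hx)⟩
  have h3 := Finset.card_le_card h2
  rw [h1, Finset.card_erase_of_mem (by simp [Ne.symm huv]), Finset.card_erase_of_mem (by simp)] at h3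
  simp at h3
  have := u.2
  have := v.2
  have : n ≠ 1 := by
    rintro rfl
    exact huv (Subsingleton.elim _ _)
  omega

lemma root_bd (d : Fin n → ℕ) (hd : ∀ i, 1 ≤ d i) (E : Path d) (hE : E ∈ execFin d) :
    (∑ j, (if IsNonRootV E (E j).2.1 then (0:ℝ) else 1) * (d (E j).1.1 : ℝ))^2 ≤
      √(∑ i, (d i : ℝ)^2) * ∑ i, (d i : ℝ)^2 := by
  refine (Finset.sum_mul_sq_le_sq_mul_sq _ _ _).trans ?_
  gcongr
  · have e : ∀ j, (if IsNonRootV E (E j).2.1 then (0:ℝ) else 1)^2 = (fun u => if IsNonRootV E u then (0:ℝ) else 1) (E j).2.1 := by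
      intro j; simp only; split_ifs <;> simp
    simp_rw [e]
    rw [cc_fiber E (fun u => if IsNonRootV E u then (0:ℝ) else 1)]
    by_cases h : ∃ v, ¬ IsNonRootV E v
    · obtain ⟨v, hv⟩ := h
      rw [Finset.sum_eq_single v]
      · rw [if_neg hv, mul_one]
        apply Real.le_sqrt_of_sq_le
        have h1 : (cc E v : ℝ) ≤ d v := by
          have := exec_cc_le d hd E hE v
          exact_mod_cast (by omega : cc E v ≤ d v)
        calc (cc E v : ℝ)^2 ≤ (d v : ℝ)^2 := by gcongr
          _ ≤ _ := Finset.single_le_sum (f := fun i => (d i : ℝ)^2) (fun i _ => by positivity) (Finset.mem_univ v)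
      · intro u _ huv
        rw [if_pos, mul_zero]
        by_contra hu
        exact huv (root_unique d hd E hE u v hu hv)
      · simp
    · push Not at h
      simp [h]
  · have := Finset.sum_image (s := (Finset.univ : Finset (Fin (n-1)))) (g := fun j => (E j).1.1) (f := fun i => (d i : ℝ)^2)
      (fun a _ b _ hab => exec_inj d hd E hE hab)
    rw [← this]
    exact Finset.sum_le_sum_of_subset_of_nonneg (Finset.subset_univ _) fun _ _ _ => by positivity

noncomputable def Wf {d : Fin n → ℕ} (φ : ℕ → ℕ → ℝ) (E : Path d) : ℝ :=
  ∑ j, φ (minusDeg E (E j).1.1) (minusDeg E (E j).2.1)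

lemma W_bd (d : Fin n → ℕ) (hd : ∀ i, 1 ≤ d i) (E : Path d) (hE : E ∈ execFin d) (φ : ℕ → ℕ → ℝ)
    (hφ : ∀ k l, |φ k (l+1) - φ k l| ≤ k + 1) :
    |Wf φ E - Zf φ E| ≤ ∑ j, (if IsNonRootV E (E j).2.1 then (0:ℝ) else 1) * (d (E j).1.1 : ℝ) := by
  unfold Wf Zf
  rw [← Finset.sum_sub_distrib]
  refine (Finset.abs_sum_le_sum_abs _ _).trans (Finset.sum_le_sum fun j _ => ?_)
  have h1 : minusDeg E (E j).1.1 = kk E (E j).1.1 := by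
    unfold minusDeg kk
    rw [if_pos ⟨j, rfl⟩]; omega
  rw [h1]
  split_ifs with h
  · have h2 : minusDeg E (E j).2.1 = kk E (E j).2.1 := by
      unfold minusDeg kk
      rw [if_pos h]; omega
    rw [h2]; simp
  · have h2 : minusDeg E (E j).2.1 = kk E (E j).2.1 + 1 := by
      unfold minusDeg kk
      have := exec_cc_le d hd E hE (E j).2.1
      have := hd (E j).2.1
      rw [if_neg h]; omega
    rw [h2, one_mul]
    refine (hφ _ _).trans ?_
    have : kk E (E j).1.1 + 1 ≤ d (E j).1.1 := by unfold kk; have := hd (E j).1.1; omega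
    exact_mod_cast this

lemma Acount_eq (d : Fin n → ℕ) (hd : ∀ i, 1 ≤ d i) (E : Path d) (hE : E ∈ execFin d) (k l : ℕ) :
    (Acount E k l : ℝ) = ∑ j, if (k, l) = (minusDeg E (E j).1.1, minusDeg E (E j).2.1) then (1:ℝ) else 0 := by
  have hi := exec_inj d hd E hE
  have hp : ∀ j, parentOf E (E j).1.1 = (E j).2.1 := by
    intro j
    unfold parentOf
    have h : ∃ k, (E k).1.1 = (E j).1.1 := ⟨j, rfl⟩
    rw [dif_pos h]
    have := hi h.choose_spec
    rw [this]
  rw [Finset.sum_boole]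
  unfold Acount
  rw [Nat.card_eq_fintype_card, Fintype.card_subtype]
  congr 1
  rw [← Finset.card_image_of_injective _ hi]
  congr 1
  ext u
  simp only [Finset.mem_filter, Finset.mem_univ, true_and, Finset.mem_image, Prod.mk.injEq]
  constructor
  · rintro ⟨⟨j, rfl⟩, h1, h2⟩
    rw [hp] at h2
    exact ⟨j, ⟨h1.symm, h2.symm⟩, rfl⟩
  · rintro ⟨j, ⟨h1, h2⟩, rfl⟩
    refine ⟨⟨j, rfl⟩, h1.symm, ?_⟩
    rw [hp]; exact h2.symm

lemma Acount_W (d : Fin n → ℕ) (hd : ∀ i, 1 ≤ d i) (E : Path d) (hE : E ∈ execFin d) (k l : ℕ) :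
    (Acount E k l : ℝ) = Wf (fun k' l' => if (k, l) = (k', l') then (1:ℝ) else 0) E := by
  rw [Acount_eq d hd E hE]; rfl

lemma tsum_Acount (d : Fin n → ℕ) (hd : ∀ i, 1 ≤ d i) (E : Path d) (hE : E ∈ execFin d) :
    ∑' kl : ℕ × ℕ, (kl.1 : ℝ) * kl.2 * Acount E kl.1 kl.2 = Wf (fun k l => (k:ℝ) * l) E := by
  simp_rw [Acount_eq d hd E hE, Finset.mul_sum]
  have h : ∀ j, HasSum (fun kl : ℕ × ℕ => (kl.1 : ℝ) * kl.2 * 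
      (if (kl.1, kl.2) = (minusDeg E (E j).1.1, minusDeg E (E j).2.1) then (1:ℝ) else 0))
      ((minusDeg E (E j).1.1 : ℝ) * minusDeg E (E j).2.1) := by
    intro j
    have := hasSum_ite_eq (minusDeg E (E j).1.1, minusDeg E (E j).2.1) ((minusDeg E (E j).1.1 : ℝ) * minusDeg E (E j).2.1)
    convert this using 1
    funext kl
    by_cases hk : kl = (minusDeg E (E j).1.1, minusDeg E (E j).2.1)
    · rw [hk]; simp
    · rw [if_neg hk, if_neg hk, mul_zero]
  exact (hasSum_sum fun j _ => h j).tsum_eq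

lemma alpha_eq (p : ℕ → ℝ) (k l : ℕ) :
    ∑' z, LLf p (fun k' l' => if (k, l) = (k', l') then (1:ℝ) else 0) z = alphaF p k l := by
  have hi : Function.Injective (fun a : ℕ × ℕ => ((k, a.1), (l, a.2))) := by
    rintro ⟨a, b⟩ ⟨a', b'⟩ h
    simp at h
    simp [h]
  rw [← hi.tsum_eq]
  · unfold alphaF
    refine tsum_congr fun a => ?_
    simp only [LLf, wt, if_true]
    ring
  · rintro ⟨⟨k', a⟩, ⟨l', b⟩⟩ h
    simp only [LLf, Function.mem_support, ne_eq, Prod.mk.injEq] at h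
    by_cases h2 : k = k' ∧ l = l'
    · obtain ⟨rfl, rfl⟩ := h2
      exact ⟨(a, b), rfl⟩
    · rw [if_neg h2] at h; simp at h

lemma alpha_tsum (p : ℕ → ℝ) (h : Summable (LLf p (fun k l => (k:ℝ) * l))) :
    ∑' z, LLf p (fun k l => (k:ℝ) * l) z = ∑' kl : ℕ × ℕ, (kl.1 : ℝ) * kl.2 * alphaF p kl.1 kl.2 := by
  rw [← (Equiv.prodProdProdComm ℕ ℕ ℕ ℕ).tsum_eq]
  rw [← (Equiv.prodProdProdComm ℕ ℕ ℕ ℕ).summable_iff] at h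
  refine Eq.trans (Summable.tsum_prod h) ?_
  refine tsum_congr fun kl => ?_
  unfold alphaF
  rw [← tsum_mul_left]
  refine tsum_congr fun a => ?_
  simp only [Function.comp, Equiv.prodProdProdComm_apply, LLf, wt]
  ring

lemma W_lim {dseq : (n : ℕ) → Fin n → ℕ} (hd : ∀ n i, 1 ≤ dseq n i)
    (μ2 : ℝ) (hμ2conv : Tendsto (fun n => (∑ i, (dseq n i : ℝ) ^ 2) / n) atTop (nhds μ2))
    (φ : ℕ → ℕ → ℝ) (hφ : ∀ k l, |φ k (l+1) - φ k l| ≤ k + 1) (L : ℝ)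
    (hZ : Tendsto (fun n => avE (dseq n) (fun E => |Zf φ E / n - L|)) atTop (nhds 0)) :
    Tendsto (fun n => avE (dseq n) (fun E => |Wf φ E / n - L|)) atTop (nhds 0) := by
  have h0 := tendsto_one_div_atTop_nhds_zero_nat (𝕜 := ℝ)
  have h1 := ((hμ2conv.sqrt.mul hμ2conv).mul h0.sqrt).sqrt
  simp only [Real.sqrt_zero, mul_zero] at h1
  have h2 := h1.add hZ
  rw [add_zero] at h2
  refine squeeze_zero' (Eventually.of_forall fun n => avE_nonneg _ fun E => abs_nonneg _) ?_ h2
  filter_upwards [eventually_gt_atTop 0] with n hn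
  have hn0 : (0:ℝ) < n := by exact_mod_cast hn
  set S := ∑ i, (dseq n i : ℝ)^2 with hS
  have hS0 : 0 ≤ S := by positivity
  set B := √(√(S / n) * (S / n) * √(1 / n)) with hB
  have hpt : ∀ E ∈ execFin (dseq n), |Wf φ E / n - L| ≤ B + |Zf φ E / n - L| := by
    intro E hE
    have b1 := W_bd (dseq n) (hd n) E hE φ hφ
    have b2 := root_bd (dseq n) (hd n) E hE
    set R := ∑ j, (if IsNonRootV E (E j).2.1 then (0:ℝ) else 1) * (dseq n (E j).1.1 : ℝ)
    have e : Wf φ E / n - L = (Wf φ E - Zf φ E) / n + (Zf φ E / n - L) := by ring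
    rw [e]
    refine (abs_add_le _ _).trans ?_
    gcongr
    rw [abs_div, abs_of_pos hn0]
    apply Real.le_sqrt_of_sq_le
    have e2 : √(S / n) * (S / n) * √(1 / n) = √S * S / n^2 := by
      rw [Real.sqrt_div hS0, Real.sqrt_div zero_le_one, Real.sqrt_one]
      have : √(n:ℝ) * √(n:ℝ) = n := Real.mul_self_sqrt hn0.le
      have h3 : 0 < √(n:ℝ) := Real.sqrt_pos.2 hn0
      have h4 : √S / √(n:ℝ) * (S / n) * (1 / √(n:ℝ)) = √S * S / ((√(n:ℝ) * √(n:ℝ)) * n) := by ring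
      rw [h4, this, sq]
    rw [e2, div_pow]
    gcongr
    exact (pow_le_pow_left₀ (abs_nonneg _) b1 2).trans b2
  refine (avE_mono _ hpt).trans ?_
  rw [avE_add]
  gcongr
  exact avE_const _ _ (Real.sqrt_nonneg _)

end PartV


section PartX
variable {n : ℕ}

lemma card_used (d : Fin n → ℕ) (hd : ∀ i, 1 ≤ d i) (E : Path d) (hE : E ∈ execFin d) :
    Fintype.card {h // UsedIn E h} = Fintype.card (Fin (n-1) ⊕ Fin (n-1)) := by
  symm
  have hE' := hE
  simp only [execFin, Finset.mem_filter, Finset.mem_univ, true_and] at hE'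
  rw [exec_iff d hd] at hE'
  obtain ⟨h1, h2, h3, h4⟩ := hE'
  have hi := exec_inj d hd E hE
  refine Fintype.card_of_bijective (f := fun x => (Sum.elim (fun k => ⟨(E k).1, Or.inl ⟨k, rfl⟩⟩) 
    (fun k => ⟨(E k).2, Or.inr ⟨k, rfl⟩⟩) x : {h // UsedIn E h})) ⟨?_, ?_⟩
  · rintro (a | a) (b | b) h
    · replace h : (E a).1 = (E b).1 := congrArg Subtype.val h
      rw [hi (show (E a).1.1 = (E b).1.1 by rw [h])]
    · replace h : (E a).1 = (E b).2 := congrArg Subtype.val h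
      have := h1 a; have h5 := h2 b
      rw [h] at this
      unfold IsRootHE at this; unfold IsNonRootHE at h5; omega
    · replace h : (E a).2 = (E b).1 := congrArg Subtype.val h
      have := h1 b; have h5 := h2 a
      rw [← h] at this
      unfold IsRootHE at this; unfold IsNonRootHE at h5; omega
    · replace h : (E a).2 = (E b).2 := congrArg Subtype.val h
      rw [h3 h]
  · rintro ⟨h, ⟨k, rfl⟩ | ⟨k, rfl⟩⟩
    · exact ⟨Sum.inl k, rfl⟩
    · exact ⟨Sum.inr k, rfl⟩

noncomputable def cM {d : Fin n → ℕ} (E : Path d) : ℕ := (Finset.univ.filter (IsCompletion E)).card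

lemma cM_le (d : Fin n → ℕ) (hd : ∀ i, 1 ≤ d i) (E E' : Path d) (hE : E ∈ execFin d) (hE' : E' ∈ execFin d) :
    cM E ≤ cM E' := by
  have hc : Fintype.card {h // UsedIn E h} = Fintype.card {h // UsedIn E' h} := by
    rw [card_used d hd E hE, card_used d hd E' hE']
  let e := Fintype.equivOfCardEq hc
  let σ : Equiv.Perm (HE d) := e.extendSubtype
  have hσ : ∀ h, UsedIn E' (σ h) ↔ UsedIn E h := by
    intro h
    constructor
    · intro h1
      by_contra h2
      exact e.extendSubtype_not_mem h h2 h1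
    · intro h1; exact e.extendSubtype_mem h h1
  unfold cM
  refine Finset.card_le_card_of_injOn (fun M => σ ∘ M ∘ σ.symm) ?_ ?_
  · intro M hM
    simp only [Finset.coe_filter, Finset.mem_univ, true_and, Set.mem_setOf_eq] at hM ⊢
    obtain ⟨h1, h2⟩ := hM
    refine ⟨fun h => by simp [h1 (σ.symm h)], fun h => ?_⟩
    obtain ⟨g, rfl⟩ := σ.surjective h
    rw [hσ, ← h2]
    simp
  · intro M _ M' _ h
    funext x
    have := congrFun h (σ x)
    simpa using this

lemma card_pairs (d : Fin n → ℕ) (P : Path d → Prop) :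
    Nat.card {x : Path d × (HE d → HE d) // (IsExecPath d x.1 ∧ IsCompletion x.1 x.2) ∧ P x.1} =
      ∑ E ∈ (execFin d).filter P, cM E := by
  rw [Nat.card_eq_fintype_card, Fintype.card_subtype, Finset.card_filter, Fintype.sum_prod_type]
  rw [execFin, Finset.filter_filter, Finset.sum_filter]
  refine Finset.sum_congr rfl fun E _ => ?_
  unfold cM
  by_cases h : IsExecPath d E ∧ P E
  · rw [if_pos h, Finset.card_filter]
    refine Finset.sum_congr rfl fun M _ => ?_
    simp [h.1, h.2]
  · rw [if_neg h]
    refine Finset.sum_eq_zero fun M _ => ?_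
    rw [if_neg]
    exact fun h' => h ⟨h'.1.1, h'.2⟩

lemma markov (d : Fin n → ℕ) (hd : ∀ i, 1 ≤ d i) (X : Path d → ℝ) (ε : ℝ) (hε : 0 < ε) :
    (Nat.card {x : Path d × (HE d → HE d) // (IsExecPath d x.1 ∧ IsCompletion x.1 x.2) ∧ ε < |X x.1|} : ℝ)
      / (Nat.card {x : Path d × (HE d → HE d) // IsExecPath d x.1 ∧ IsCompletion x.1 x.2} : ℝ)
      ≤ (1/ε) * avE d (fun E => |X E|) := by
  have h1 := card_pairs d (fun E => ε < |X E|)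
  have h2 := card_pairs d (fun E => True)
  simp only [and_true, Finset.filter_true] at h2
  rw [h1, h2]
  rcases (execFin d).eq_empty_or_nonempty with h | ⟨E0, h0⟩
  · simp [h, avE]
  have hC : ∀ E ∈ execFin d, cM E = cM E0 := fun E hE => le_antisymm (cM_le d hd E E0 hE h0) (cM_le d hd E0 E h0 hE)
  rw [Finset.sum_congr rfl hC, Finset.sum_congr rfl fun E hE => hC E (Finset.filter_subset _ _ hE)]
  simp only [Finset.sum_const, smul_eq_mul]
  push_cast
  have hb : (0:ℝ) < (execFin d).card := by exact_mod_cast Finset.card_pos.2 ⟨E0, h0⟩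
  have h3 : (((execFin d).filter (fun E => ε < |X E|)).card : ℝ) * ε ≤ ∑ E ∈ execFin d, |X E| := by
    rw [← nsmul_eq_mul, ← Finset.sum_const]
    calc _ ≤ ∑ E ∈ (execFin d).filter (fun E => ε < |X E|), |X E| := by
          refine Finset.sum_le_sum fun E hE => ?_
          exact (Finset.mem_filter.1 hE).2.le
      _ ≤ _ := Finset.sum_le_sum_of_subset_of_nonneg (Finset.filter_subset _ _) fun _ _ _ => abs_nonneg _
  rcases Nat.eq_zero_or_pos (cM E0) with hc | hc
  · rw [hc]; simp
    exact mul_nonneg (by positivity) (avE_nonneg _ fun E => abs_nonneg _)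
  have hc' : (0:ℝ) < cM E0 := by exact_mod_cast hc
  rw [mul_div_mul_right _ _ hc'.ne']
  unfold avE
  rw [div_mul_eq_mul_div, one_mul, div_div, div_le_div_iff₀ hb (by positivity)]
  nlinarith

lemma final_step {dseq : (n : ℕ) → Fin n → ℕ} (hd : ∀ n i, 1 ≤ dseq n i) (Y : (n : ℕ) → Path (dseq n) → ℝ)
    (φ : ℕ → ℕ → ℝ) (hY : ∀ n, ∀ E ∈ execFin (dseq n), Y n E = Wf φ E) (L : ℝ)
    (hW : Tendsto (fun n => avE (dseq n) (fun E => |Wf φ E / n - L|)) atTop (nhds 0)) (ε : ℝ) (hε : 0 < ε) :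
    Tendsto (fun n => (Nat.card {x : Path (dseq n) × (HE (dseq n) → HE (dseq n)) //
            (IsExecPath (dseq n) x.1 ∧ IsCompletion x.1 x.2) ∧
            ε < |Y n x.1 / n - L|} : ℝ)
          / (Nat.card {x : Path (dseq n) × (HE (dseq n) → HE (dseq n)) //
              IsExecPath (dseq n) x.1 ∧ IsCompletion x.1 x.2} : ℝ)) atTop (nhds 0) := by
  have h := hW.const_mul (1/ε)
  rw [mul_zero] at h
  refine squeeze_zero (fun n => by positivity) (fun n => ?_) h
  refine (markov (dseq n) (hd n) (fun E => Y n E / n - L) ε hε).trans ?_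
  gcongr
  apply avE_mono
  intro E hE
  rw [hY n E hE]

end PartX

/-- For the random tree-rooted graph `(G(dⁿ), T(dⁿ), Γ(dⁿ))` (sampled as a uniform
pair of an execution path and a completing matching), `n⁻¹ Aⁿ(k,ℓ) → α(k,ℓ)` in
probability for all `k, ℓ ≥ 0`, and `n⁻¹ ∑_{k,ℓ} kℓ Aⁿ(k,ℓ) → ∑_{k,ℓ} kℓ α(k,ℓ)` in
probability. -/
theorem Akl_convergence
    (dseq : (n : ℕ) → Fin n → ℕ)
    (hd : ∀ n i, 1 ≤ dseq n i)
    (heven : ∀ n, Even (∑ i, dseq n i))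
    (hge : ∀ n, 2 * n ≤ ∑ i, dseq n i)
    (p : ℕ → ℝ) (hp0 : p 0 = 0) (hpnn : ∀ k, 0 ≤ p k) (hp1 : HasSum p 1)
    (hp2 : p 2 < 1)
    (μ2 : ℝ) (hμ2 : HasSum (fun k : ℕ => (k : ℝ) ^ 2 * p k) μ2) (hμ2pos : 0 < μ2)
    (hpconv : ∀ k : ℕ, Tendsto
      (fun n => (Nat.card {i : Fin n // dseq n i = k} : ℝ) / n) atTop (nhds (p k)))
    (hμ2conv : Tendsto (fun n => (∑ i, (dseq n i : ℝ) ^ 2) / n) atTop (nhds μ2)) :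
    (∀ k l : ℕ, ∀ ε : ℝ, 0 < ε → Tendsto (fun n =>
        (Nat.card {x : Path (dseq n) × (HE (dseq n) → HE (dseq n)) //
            (IsExecPath (dseq n) x.1 ∧ IsCompletion x.1 x.2) ∧
            ε < |(Acount x.1 k l : ℝ) / n - alphaF p k l|} : ℝ)
          / (Nat.card {x : Path (dseq n) × (HE (dseq n) → HE (dseq n)) //
              IsExecPath (dseq n) x.1 ∧ IsCompletion x.1 x.2} : ℝ))
        atTop (nhds 0))
    ∧ (∀ ε : ℝ, 0 < ε → Tendsto (fun n =>
        (Nat.card {x : Path (dseq n) × (HE (dseq n) → HE (dseq n)) //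
            (IsExecPath (dseq n) x.1 ∧ IsCompletion x.1 x.2) ∧
            ε < |(∑' kl : ℕ × ℕ, (kl.1 : ℝ) * kl.2 * Acount x.1 kl.1 kl.2) / n
                  - ∑' kl : ℕ × ℕ, (kl.1 : ℝ) * kl.2 * alphaF p kl.1 kl.2|} : ℝ)
          / (Nat.card {x : Path (dseq n) × (HE (dseq n) → HE (dseq n)) //
              IsExecPath (dseq n) x.1 ∧ IsCompletion x.1 x.2} : ℝ))
        atTop (nhds 0)) := by
  have hpc := hpconv
  have hm := mean_lim hpnn hpconv μ2 hμ2 hμ2conv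
  have h2 := mu1_ge hge hm
  have hrho := rho_lim hd hge hm
  have hN : ∀ n, n ≤ Nn (dseq n) := fun n => Nn_ge (dseq n) (hd n) (hge n)
  have hw := fun x => wt_nonneg hpnn h2 x
  have hs := wt_summable hpnn h2 μ2 hμ2
  constructor
  · intro k l ε hε
    set φ : ℕ → ℕ → ℝ := fun k' l' => if (k, l) = (k', l') then (1:ℝ) else 0 with hφd
    have hφ0 : ∀ a b, 0 ≤ φ a b := fun a b => by simp only [hφd]; split_ifs <;> simp
    have hφ1 : ∀ a b, φ a b ≤ 1 := fun a b => by simp only [hφd]; split_ifs <;> simp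
    have hφ : ∀ a b : ℕ, φ a b ≤ ((a:ℝ)+1)*(b+1) := fun a b => by
      refine (hφ1 a b).trans ?_
      have ha : (0:ℝ) ≤ a := by positivity
      have hb : (0:ℝ) ≤ b := by positivity
      nlinarith
    have hφd : ∀ a b : ℕ, |φ a (b+1) - φ a b| ≤ a + 1 := fun a b => by
      have ha : (0:ℝ) ≤ a := by positivity
      rw [abs_le]
      constructor <;> linarith [hφ0 a b, hφ1 a b, hφ0 a (b+1), hφ1 a (b+1)]
    have hZ := Zf_lim hd hpconv hN hrho hw hs μ2 hμ2 hμ2pos hμ2conv φ hφ0 hφ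
    have hW := W_lim hd μ2 hμ2conv φ hφd _ hZ
    rw [alpha_eq p k l] at hW
    exact final_step hd (fun n E => (Acount E k l : ℝ)) φ
      (fun n E hE => Acount_W (dseq n) (hd n) E hE k l) _ hW ε hε
  · intro ε hε
    set φ : ℕ → ℕ → ℝ := fun k l => (k:ℝ) * l with hφd
    have hφ0 : ∀ a b, 0 ≤ φ a b := fun a b => by simp only [hφd]; positivity
    have hφ : ∀ a b : ℕ, φ a b ≤ ((a:ℝ)+1)*(b+1) := fun a b => by
      simp only [hφd]; gcongr <;> linarith
    have hφd' : ∀ a b : ℕ, |φ a (b+1) - φ a b| ≤ a + 1 := fun a b => by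
      simp only [hφd]
      push_cast
      have : (a:ℝ) * (b + 1) - a * b = a := by ring
      rw [this, abs_of_nonneg (by positivity)]; linarith
    have hZ := Zf_lim hd hpconv hN hrho hw hs μ2 hμ2 hμ2pos hμ2conv φ hφ0 hφ
    have hW := W_lim hd μ2 hμ2conv φ hφd' _ hZ
    rw [alpha_tsum p (LLf_summable hw hs φ hφ0 hφ)] at hW
    exact final_step hd (fun n E => ∑' kl : ℕ × ℕ, (kl.1 : ℝ) * kl.2 * Acount E kl.1 kl.2) φ
      (fun n E hE => tsum_Acount (dseq n) (hd n) E hE) _ hW ε hε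

end TWG
end

section
/- Let p = (p(k), k ≥ 1) be a probability distribution on the positive integers with 2 ≤ μ1(p) < ∞, and set ρ = 1/(μ1(p)−1) ∈ (0,1]. Then: (i) ∑_{k≥0} ∑_{a₁≥0} p(k+a₁+1)·P(Bin(k+a₁,ρ)=a₁) = 1; (ii) ∑_{ℓ≥0} ∑_{a₂≥0} a₂·p(ℓ+a₂+1)·P(Bin(ℓ+a₂,ρ)=a₂) = 1; and consequently (iii) ∑_{k,ℓ≥0} α(k,ℓ) = 1, i.e., α defines a probability distribution on pairs of nonnegative integers. -/
namespace TWG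

lemma binomP_eq_eval (ρ : ℝ) (m a : ℕ) :
    binomP ρ m a = (bernsteinPolynomial ℝ m a).eval ρ := by
  simp [binomP, bernsteinPolynomial]

lemma sum_binomP (ρ : ℝ) (n : ℕ) :
    ∑ x ∈ Finset.HasAntidiagonal.antidiagonal n, binomP ρ (x.1 + x.2) x.2 = 1 := by
  have h := congrArg (Polynomial.eval ρ) (bernsteinPolynomial.sum ℝ n)
  rw [Polynomial.eval_finsetSum, Polynomial.eval_one] at h
  rw [← Finset.Nat.sum_antidiagonal_swap, ← h,
    Finset.Nat.sum_antidiagonal_eq_sum_range_succ_mk]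
  refine Finset.sum_congr rfl fun a ha => ?_
  have : a ≤ n := by simpa [Nat.lt_succ_iff] using ha
  simp [binomP_eq_eval, Nat.sub_add_cancel this]

lemma sum_mul_binomP (ρ : ℝ) (n : ℕ) :
    ∑ x ∈ Finset.HasAntidiagonal.antidiagonal n, (x.2 : ℝ) * binomP ρ (x.1 + x.2) x.2 = n * ρ := by
  have h := congrArg (Polynomial.eval ρ) (bernsteinPolynomial.sum_smul ℝ n)
  rw [Polynomial.eval_finsetSum] at h
  have h2 : Polynomial.eval ρ (n • (Polynomial.X : Polynomial ℝ)) = n * ρ := by simp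
  rw [← h2, ← Finset.Nat.sum_antidiagonal_swap, ← h,
    Finset.Nat.sum_antidiagonal_eq_sum_range_succ_mk]
  refine Finset.sum_congr rfl fun a ha => ?_
  have : a ≤ n := by simpa [Nat.lt_succ_iff] using ha
  simp [binomP_eq_eval, Nat.sub_add_cancel this]

lemma hasSum_of_antidiagonal (f : ℕ × ℕ → ℝ) (hf : ∀ x, 0 ≤ f x) (g : ℕ → ℝ) (s : ℝ)
    (hg : ∀ n, ∑ x ∈ Finset.HasAntidiagonal.antidiagonal n, f x = g n) (h : HasSum g s) : HasSum f s := by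
  rw [← Finset.HasAntidiagonal.sigmaAntidiagonalEquivProd.hasSum_iff]
  have key : ∀ n, HasSum (fun c : Finset.HasAntidiagonal.antidiagonal n => f c) (g n) := fun n => by
    rw [← hg n]
    exact Finset.hasSum _ f
  have hs : Summable (f ∘ Finset.HasAntidiagonal.sigmaAntidiagonalEquivProd) := by
    refine (summable_sigma_of_nonneg (fun x => hf (Finset.HasAntidiagonal.sigmaAntidiagonalEquivProd x))).2 ?_
    refine ⟨fun n => (key n).summable, ?_⟩
    exact h.summable.congr fun n => (key n).tsum_eq.symm
  have h3 := hs.hasSum.sigma (g := g) key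
  rw [h.unique h3]
  exact hs.hasSum

/-- For a probability distribution `p` on the positive integers with `2 ≤ μ₁(p) < ∞`
and `ρ = 1/(μ₁(p)-1)`:
(i) `∑_{k,a₁} p(k+a₁+1) P(Bin(k+a₁,ρ)=a₁) = 1`;
(ii) `∑_{ℓ,a₂} a₂ p(ℓ+a₂+1) P(Bin(ℓ+a₂,ρ)=a₂) = 1`;
(iii) consequently `∑_{k,ℓ} α(k,ℓ) = 1`, i.e. `α` is a probability distribution on
pairs of nonnegative integers. -/
theorem alpha_prob_dist (p : ℕ → ℝ) (hp0 : p 0 = 0) (hpnn : ∀ k, 0 ≤ p k)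
    (hp1 : HasSum p 1)
    (hμ1 : Summable (fun k : ℕ => (k : ℝ) * p k)) (hμ1ge : 2 ≤ mu1 p) :
    (∑' x : ℕ × ℕ, p (x.1 + x.2 + 1) * binomP (rho p) (x.1 + x.2) x.2) = 1
    ∧ (∑' x : ℕ × ℕ, (x.2 : ℝ) * p (x.1 + x.2 + 1) * binomP (rho p) (x.1 + x.2) x.2) = 1
    ∧ (∑' kl : ℕ × ℕ, alphaF p kl.1 kl.2) = 1 := by
  have hm : 0 < mu1 p - 1 := by linarith
  have hρ0 : 0 ≤ rho p := by unfold rho; positivity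
  have hρ1 : rho p ≤ 1 := by
    unfold rho
    rw [div_le_one hm]
    linarith
  have hb : ∀ m a, 0 ≤ binomP (rho p) m a := fun m a => by
    have : 0 ≤ 1 - rho p := by linarith
    unfold binomP
    positivity
  have e1 : HasSum (fun n => p (n + 1)) 1 := by
    rw [hasSum_nat_add_iff (f := p) 1]
    simpa [hp0] using hp1
  have e2 : HasSum (fun n : ℕ => ((n + 1 : ℕ) : ℝ) * p (n + 1)) (mu1 p) := by
    rw [hasSum_nat_add_iff (f := fun k : ℕ => (k : ℝ) * p k) 1]
    simpa [mu1] using hμ1.hasSum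
  have e3 : HasSum (fun n : ℕ => p (n + 1) * (n * rho p)) 1 := by
    have h := (e2.sub e1).mul_right (rho p)
    have h1 : (mu1 p - 1) * rho p = 1 := by
      unfold rho
      field_simp
    rw [h1] at h
    refine h.congr_fun ?_
    intro n
    push_cast
    ring
  have i1 : HasSum (fun x : ℕ × ℕ => p (x.1 + x.2 + 1) * binomP (rho p) (x.1 + x.2) x.2) 1 := by
    refine hasSum_of_antidiagonal _ (fun x => mul_nonneg (hpnn _) (hb _ _)) _ _ (fun n => ?_) e1
    rw [← mul_one (p (n + 1)), ← sum_binomP (rho p) n, Finset.mul_sum]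
    refine Finset.sum_congr rfl fun x hx => ?_
    rw [Finset.HasAntidiagonal.mem_antidiagonal.1 hx]
  have i2 : HasSum (fun x : ℕ × ℕ =>
      (x.2 : ℝ) * p (x.1 + x.2 + 1) * binomP (rho p) (x.1 + x.2) x.2) 1 := by
    refine hasSum_of_antidiagonal _
      (fun x => mul_nonneg (mul_nonneg (Nat.cast_nonneg _) (hpnn _)) (hb _ _)) _ _ (fun n => ?_) e3
    rw [← sum_mul_binomP (rho p) n, Finset.mul_sum]
    refine Finset.sum_congr rfl fun x hx => ?_
    rw [Finset.HasAntidiagonal.mem_antidiagonal.1 hx]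
    ring
  refine ⟨i1.tsum_eq, i2.tsum_eq, ?_⟩
  have hs := i2.summable.mul_of_nonneg i1.summable
    (fun x => mul_nonneg (mul_nonneg (Nat.cast_nonneg _) (hpnn _)) (hb _ _))
    (fun x => mul_nonneg (hpnn _) (hb _ _))
  have h := i2.mul i1 hs
  rw [mul_one] at h
  let e : (ℕ × ℕ) × (ℕ × ℕ) ≃ (ℕ × ℕ) × (ℕ × ℕ) :=
    { toFun := fun x => ((x.1.2, x.2.2), (x.1.1, x.2.1))
      invFun := fun x => ((x.2.1, x.1.1), (x.2.2, x.1.2))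
      left_inv := fun _ => rfl
      right_inv := fun _ => rfl }
  have h' := e.hasSum_iff.2 h
  rw [← h'.tsum_eq, h'.summable.tsum_prod]
  rfl

end TWG
end

section
/- Let p = (p(k), k ≥ 1) be a probability distribution on the positive integers with 2 ≤ μ1(p) < ∞ and μ2(p) < ∞, and set ρ = 1/(μ1(p)−1) ∈ (0,1]. Then ∑_{k,ℓ≥0} kℓ·α(k,ℓ) ≤ μ2(p) − 2μ1(p) + 1 < ∞. -/
namespace TWG

/-- `μ₂(p) = ∑ k, k²⋅p(k)`. -/
noncomputable def mu2 (p : ℕ → ℝ) : ℝ := ∑' k : ℕ, (k : ℝ) ^ 2 * p k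

lemma hasSum_congr_aux {f g : ℕ → ℝ} {S : ℝ} (h : HasSum f S) (e : ∀ n, g n = f n) :
    HasSum g S := by
  rwa [funext e]

lemma binom_sum0 (r : ℝ) (n : ℕ) :
    ∑ a ∈ Finset.range (n + 1), binomP r n a = 1 := by
  have h := congrArg (Polynomial.eval r) (bernsteinPolynomial.sum ℝ n)
  simpa [Polynomial.eval_finsetSum, bernsteinPolynomial, binomP] using h

lemma binom_sum1 (r : ℝ) (n : ℕ) :
    ∑ a ∈ Finset.range (n + 1), (a : ℝ) * binomP r n a = n * r := by
  have h := congrArg (Polynomial.eval r) (bernsteinPolynomial.sum_smul ℝ n)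
  simpa [Polynomial.eval_finsetSum, bernsteinPolynomial, binomP] using h

lemma binom_sum2 (r : ℝ) (n : ℕ) :
    ∑ a ∈ Finset.range (n + 1), (a : ℝ) * (a - 1) * binomP r n a = n * (n - 1) * r ^ 2 := by
  have h := congrArg (Polynomial.eval r) (bernsteinPolynomial.sum_mul_smul ℝ n)
  have e : ∀ a : ℕ, ((a * (a - 1) : ℕ) : ℝ) = (a : ℝ) * (a - 1) := by
    intro a; cases a <;> simp
  simp only [Polynomial.eval_finsetSum, bernsteinPolynomial, nsmul_eq_mul, Polynomial.eval_mul,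
    Polynomial.eval_natCast, Polynomial.eval_pow, Polynomial.eval_X, Polynomial.eval_sub,
    Polynomial.eval_one, e] at h
  simpa [binomP] using h

lemma anti1 (r : ℝ) (n : ℕ) :
    ∑ x ∈ Finset.HasAntidiagonal.antidiagonal n, (x.1 : ℝ) * binomP r (x.1 + x.2) x.2 = n * (1 - r) := by
  rw [← Finset.Nat.sum_antidiagonal_swap,
    Finset.Nat.sum_antidiagonal_eq_sum_range_succ_mk]
  have : ∀ a ∈ Finset.range (n + 1),
      (((a, n - a).swap.1 : ℕ) : ℝ) * binomP r ((a, n - a).swap.1 + (a, n - a).swap.2)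
        (a, n - a).swap.2 = n * binomP r n a - a * binomP r n a := by
    intro a ha
    have ha : a ≤ n := by simpa [Nat.lt_succ_iff] using ha
    simp only [Prod.swap_prod_mk, Nat.sub_add_cancel ha, Nat.cast_sub ha]
    ring
  rw [Finset.sum_congr rfl this, Finset.sum_sub_distrib, ← Finset.mul_sum, binom_sum0, binom_sum1]
  ring

lemma anti2 (r : ℝ) (n : ℕ) :
    ∑ x ∈ Finset.HasAntidiagonal.antidiagonal n, (x.1 : ℝ) * x.2 * binomP r (x.1 + x.2) x.2
      = n * (n - 1) * (r * (1 - r)) := by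
  rw [← Finset.Nat.sum_antidiagonal_swap,
    Finset.Nat.sum_antidiagonal_eq_sum_range_succ_mk]
  have : ∀ a ∈ Finset.range (n + 1),
      (((a, n - a).swap.1 : ℕ) : ℝ) * (((a, n - a).swap.2 : ℕ) : ℝ) *
        binomP r ((a, n - a).swap.1 + (a, n - a).swap.2)
        (a, n - a).swap.2 = (n - 1) * (a * binomP r n a) - a * (a - 1) * binomP r n a := by
    intro a ha
    have ha : a ≤ n := by simpa [Nat.lt_succ_iff] using ha
    simp only [Prod.swap_prod_mk, Nat.sub_add_cancel ha, Nat.cast_sub ha]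
    ring
  rw [Finset.sum_congr rfl this, Finset.sum_sub_distrib, ← Finset.mul_sum, binom_sum1, binom_sum2]
  ring

lemma hasSum_anti (w : ℕ × ℕ → ℝ) (hw : ∀ x, 0 ≤ w x) (S : ℝ)
    (h : HasSum (fun n => ∑ x ∈ Finset.HasAntidiagonal.antidiagonal n, w x) S) : HasSum w S := by
  have hs : Summable (fun x : (Σ n : ℕ, Finset.HasAntidiagonal.antidiagonal n) => w x.2) := by
    refine (summable_sigma_of_nonneg (fun x => hw _)).2 ⟨fun n => Summable.of_finite, ?_⟩
    refine h.summable.congr fun n => ?_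
    rw [tsum_fintype]
    exact (Finset.sum_coe_sort (Finset.HasAntidiagonal.antidiagonal n) w).symm
  have hs' : Summable w :=
    (Finset.HasAntidiagonal.sigmaAntidiagonalEquivProd (A := ℕ)).summable_iff.1 hs
  have e := hs.hasSum.sigma (g := fun n => ∑ x ∈ Finset.HasAntidiagonal.antidiagonal n, w x) (fun n => by
    have := hasSum_fintype (fun x : Finset.HasAntidiagonal.antidiagonal n => w x)
    rwa [Finset.sum_coe_sort (Finset.HasAntidiagonal.antidiagonal n) w] at this)
  have e2 := h.unique e
  have e3 : ∑' x : (Σ n : ℕ, Finset.HasAntidiagonal.antidiagonal n), w x.2 = ∑' x, w x :=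
    (Finset.HasAntidiagonal.sigmaAntidiagonalEquivProd (A := ℕ)).tsum_eq w
  rw [e2, e3]
  exact hs'.hasSum

lemma binomP_nonneg {r : ℝ} (h0 : 0 ≤ r) (h1 : r ≤ 1) (n a : ℕ) : 0 ≤ binomP r n a := by
  have : 0 ≤ 1 - r := by linarith
  unfold binomP; positivity

/-- For a probability distribution `p` on the positive integers with `2 ≤ μ₁(p) < ∞`
and `μ₂(p) < ∞`, with `ρ = 1/(μ₁(p)-1)`:
`∑_{k,ℓ} kℓ α(k,ℓ) ≤ μ₂(p) − 2μ₁(p) + 1 < ∞` (the finiteness being the summability of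
the left-hand side). -/
theorem alpha_second_moment (p : ℕ → ℝ) (hp0 : p 0 = 0) (hpnn : ∀ k, 0 ≤ p k)
    (hp1 : HasSum p 1)
    (hμ1 : Summable (fun k : ℕ => (k : ℝ) * p k)) (hμ1ge : 2 ≤ mu1 p)
    (hμ2 : Summable (fun k : ℕ => (k : ℝ) ^ 2 * p k)) :
    Summable (fun kl : ℕ × ℕ => (kl.1 : ℝ) * kl.2 * alphaF p kl.1 kl.2)
    ∧ (∑' kl : ℕ × ℕ, (kl.1 : ℝ) * kl.2 * alphaF p kl.1 kl.2)
        ≤ mu2 p - 2 * mu1 p + 1 := by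
  have hm : 0 < mu1 p - 1 := by linarith
  have hr0 : 0 ≤ rho p := by unfold rho; positivity
  have hr1 : rho p ≤ 1 := by
    unfold rho; rw [div_le_one hm]; linarith
  have hrm : rho p * (mu1 p - 1) = 1 := by unfold rho; field_simp
  set r := rho p with hr
  have hb := binomP_nonneg hr0 hr1
  have H0 : HasSum (fun n => p (n + 1)) 1 := by
    have := (hasSum_nat_add_iff' 1).2 hp1
    simpa [hp0] using this
  have H1 : HasSum (fun n : ℕ => ((n + 1 : ℕ) : ℝ) * p (n + 1)) (mu1 p) := by
    have := (hasSum_nat_add_iff' 1).2 hμ1.hasSum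
    simpa [hp0, mu1] using this
  have H2 : HasSum (fun n : ℕ => ((n + 1 : ℕ) : ℝ) ^ 2 * p (n + 1)) (mu2 p) := by
    have := (hasSum_nat_add_iff' 1).2 hμ2.hasSum
    simpa [hp0, mu2] using this
  have K1 : HasSum (fun n : ℕ => (n : ℝ) * p (n + 1)) (mu1 p - 1) := by
    refine hasSum_congr_aux ((H1.sub H0)) ?_
    intro n; push_cast; ring
  have K2 : HasSum (fun n : ℕ => (n : ℝ) * (n - 1) * p (n + 1)) (mu2 p - 3 * mu1 p + 2) := by
    have := (H2.sub (H1.mul_left 3)).add (H0.mul_left 2)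
    rw [mul_one] at this
    refine hasSum_congr_aux (this) ?_
    intro n; push_cast; ring
  have F1 : HasSum (fun x : ℕ × ℕ => (x.1 : ℝ) * (p (x.1 + x.2 + 1) * binomP r (x.1 + x.2) x.2))
      ((1 - r) * (mu1 p - 1)) := by
    refine hasSum_anti _ (fun x => mul_nonneg (Nat.cast_nonneg _)
      (mul_nonneg (hpnn _) (hb _ _))) _ ?_
    refine hasSum_congr_aux ((K1.mul_left (1 - r))) ?_
    intro n
    have : ∀ x ∈ Finset.HasAntidiagonal.antidiagonal n,
        (x.1 : ℝ) * (p (x.1 + x.2 + 1) * binomP r (x.1 + x.2) x.2)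
          = p (n + 1) * (x.1 * binomP r (x.1 + x.2) x.2) := by
      intro x hx
      rw [← Finset.HasAntidiagonal.mem_antidiagonal.1 hx]; ring
    rw [Finset.sum_congr rfl this, ← Finset.mul_sum, anti1]; ring
  have F2 : HasSum (fun x : ℕ × ℕ =>
      (x.1 : ℝ) * (x.2 * p (x.1 + x.2 + 1) * binomP r (x.1 + x.2) x.2))
      (r * (1 - r) * (mu2 p - 3 * mu1 p + 2)) := by
    refine hasSum_anti _ (fun x => mul_nonneg (Nat.cast_nonneg _)
      (mul_nonneg (mul_nonneg (Nat.cast_nonneg _) (hpnn _)) (hb _ _))) _ ?_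
    refine hasSum_congr_aux ((K2.mul_left (r * (1 - r)))) ?_
    intro n
    have : ∀ x ∈ Finset.HasAntidiagonal.antidiagonal n,
        (x.1 : ℝ) * (x.2 * p (x.1 + x.2 + 1) * binomP r (x.1 + x.2) x.2)
          = p (n + 1) * (x.1 * x.2 * binomP r (x.1 + x.2) x.2) := by
      intro x hx
      rw [← Finset.HasAntidiagonal.mem_antidiagonal.1 hx]; ring
    rw [Finset.sum_congr rfl this, ← Finset.mul_sum, anti2]; ring
  have f1 := fun k => (F1.summable.prod_factor k)
  have f2 := fun k => (F2.summable.prod_factor k)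
  have G1 := F1.prod_fiberwise (fun k => (f1 k).hasSum)
  have G2 := F2.prod_fiberwise (fun k => (f2 k).hasSum)
  have key : ∀ kl : ℕ × ℕ, (kl.1 : ℝ) * kl.2 * alphaF p kl.1 kl.2 =
      (∑' a : ℕ, (kl.1 : ℝ) * (p (kl.1 + a + 1) * binomP r (kl.1 + a) a)) *
      (∑' a : ℕ, (kl.2 : ℝ) * (a * p (kl.2 + a + 1) * binomP r (kl.2 + a) a)) := by
    rintro ⟨k, l⟩
    have hs := (f1 k).mul_of_nonneg (f2 l)
      (fun a => mul_nonneg (Nat.cast_nonneg _) (mul_nonneg (hpnn _) (hb _ _)))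
      (fun a => mul_nonneg (Nat.cast_nonneg _)
        (mul_nonneg (mul_nonneg (Nat.cast_nonneg _) (hpnn _)) (hb _ _)))
    have e := (f1 k).tsum_mul_tsum (f2 l) hs
    simp only at e ⊢
    rw [e, alphaF, ← tsum_mul_left]
    refine tsum_congr fun a => ?_
    rw [← hr]; ring
  have n1 : ∀ k : ℕ, 0 ≤ ∑' a : ℕ, (k : ℝ) * (p (k + a + 1) * binomP r (k + a) a) := fun k =>
    tsum_nonneg fun a => mul_nonneg (Nat.cast_nonneg _) (mul_nonneg (hpnn _) (hb _ _))
  have n2 : ∀ k : ℕ, 0 ≤ ∑' a : ℕ, (k : ℝ) * (a * p (k + a + 1) * binomP r (k + a) a) := fun k =>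
    tsum_nonneg fun a => mul_nonneg (Nat.cast_nonneg _)
        (mul_nonneg (mul_nonneg (Nat.cast_nonneg _) (hpnn _)) (hb _ _))
  have hsum := G1.summable.mul_of_nonneg G2.summable n1 n2
  have htot := G1.mul G2 hsum
  simp only [key]
  refine ⟨hsum, ?_⟩
  rw [htot.tsum_eq]
  have hq : 0 ≤ mu2 p - 3 * mu1 p + 2 := by
    refine K2.nonneg fun n => mul_nonneg ?_ (hpnn _)
    rcases n with _ | n
    · simp
    · push_cast; ring_nf; positivity
  have e : (1 - r) * (mu1 p - 1) * (r * (1 - r) * (mu2 p - 3 * mu1 p + 2))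
      = (1 - r) ^ 2 * (mu2 p - 3 * mu1 p + 2) := by
    linear_combination ((1 - r) ^ 2 * (mu2 p - 3 * mu1 p + 2)) * hrm
  rw [e]
  have : (1 - r) ^ 2 ≤ 1 := by nlinarith
  nlinarith

end TWG
end
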